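/- arXiv:2507.12707 — 4 statements merged into one kernel-verified Lean document; each statement's English description precedes it below -/
import Mathlib

section
/- For any connected graph G on N vertices, the number of spanning forests of G with exactly k connected components is at least the number of spanning trees of G divided by N^{2(k-1)}, and at most N^{2(k-1)} times the number of spanning trees of G. -/
open SimpleGraph

/-- The number of spanning trees of `G`. -/
noncomputable def numSpanningTrees {V : Type*} [Fintype V] (G : SimpleGraph V) : ℕ :=
  Set.ncard {T : SimpleGraph V | T ≤ G ∧ T.IsTree}

/-- The number of spanning forests of `G` with exactly `k` connected components. -/
noncomputable def numSpanningForests {V : Type*} [Fintype V] (G : SimpleGraph V) (k : ℕ) : ℕ :=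
  Set.ncard {H : SimpleGraph V | H ≤ G ∧ H.IsAcyclic ∧ Nat.card H.ConnectedComponent = k}

namespace SimpleGraph

variable {V : Type*} {G H : SimpleGraph V} {u v x y : V}

theorem Reachable.of_sup_edge (h : (H ⊔ edge x y).Reachable u v) :
    H.Reachable u v ∨ (H.Reachable u x ∧ H.Reachable y v) ∨
      (H.Reachable u y ∧ H.Reachable x v) := by
  obtain ⟨p⟩ := h
  induction p with
  | nil => exact .inl .rfl
  | @cons a b c hab _ ih =>
    rw [sup_adj, edge_adj] at hab
    rcases hab with hab | ⟨⟨rfl, rfl⟩ | ⟨rfl, rfl⟩, -⟩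
    · have := hab.reachable
      rcases ih with h | ⟨h₁, h₂⟩ | ⟨h₁, h₂⟩
      · exact .inl (this.trans h)
      · exact .inr (.inl ⟨this.trans h₁, h₂⟩)
      · exact .inr (.inr ⟨this.trans h₁, h₂⟩)
    · rcases ih with h | ⟨-, h⟩ | ⟨-, h⟩
      · exact .inr (.inl ⟨.rfl, h⟩)
      · exact .inr (.inl ⟨.rfl, h⟩)
      · exact .inl h
    · rcases ih with h | ⟨-, h⟩ | ⟨-, h⟩
      · exact .inr (.inr ⟨.rfl, h⟩)
      · exact .inl h
      · exact .inr (.inr ⟨.rfl, h⟩)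

/-- Joining two distinct components by an edge lowers the number of components by one. -/
theorem card_connectedComponent_sup_edge [Finite V] (hxy : ¬ H.Reachable x y) :
    Nat.card (H ⊔ edge x y).ConnectedComponent + 1 = Nat.card H.ConnectedComponent := by
  classical
  let f : {c : H.ConnectedComponent // c ≠ H.connectedComponentMk y} →
      (H ⊔ edge x y).ConnectedComponent :=
    fun c ↦ c.1.map (Hom.ofLE le_sup_left)
  have hinj : Function.Injective f := by
    rintro ⟨c, hc⟩ ⟨d, hd⟩ h
    induction c using ConnectedComponent.ind with | _ a
    induction d using ConnectedComponent.ind with | _ b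
    rw [Ne, ConnectedComponent.eq] at hc hd
    have h : (H ⊔ edge x y).Reachable a b := ConnectedComponent.exact h
    rw [Subtype.mk_eq_mk, ConnectedComponent.eq]
    rcases h.of_sup_edge with h | ⟨-, h⟩ | ⟨h, -⟩
    · exact h
    · exact absurd h.symm hd
    · exact absurd h hc
  have hsurj : Function.Surjective f := by
    intro c
    induction c using ConnectedComponent.ind with | _ a
    by_cases ha : H.Reachable a y
    · refine ⟨⟨H.connectedComponentMk x, by rwa [Ne, ConnectedComponent.eq]⟩, ?_⟩
      refine ConnectedComponent.sound (Reachable.trans (Adj.reachable ?_)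
        (ha.symm.mono le_sup_left))
      have : x ≠ y := by
        rintro rfl
        exact hxy .rfl
      simpa [edge_adj] using Or.inr this
    · exact ⟨⟨H.connectedComponentMk a, by rwa [Ne, ConnectedComponent.eq]⟩, rfl⟩
  rw [← Nat.card_congr (Equiv.ofBijective f ⟨hinj, hsurj⟩), ← Finite.card_option,
    Nat.card_congr (Equiv.optionSubtypeNe (H.connectedComponentMk y))]

theorem isTree_iff_isAcyclic_and_card_connectedComponent :
    H.IsTree ↔ H.IsAcyclic ∧ Nat.card H.ConnectedComponent = 1 := by
  rw [isTree_iff, and_comm, Nat.card_eq_one_iff_unique, connected_iff]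
  refine and_congr_right fun _ ↦ and_congr ?_ ?_
  · exact ⟨fun h ↦ h.subsingleton_connectedComponent,
      fun h _ _ ↦ ConnectedComponent.exact (h.elim _ _)⟩
  · exact ⟨fun ⟨a⟩ ↦ ⟨H.connectedComponentMk a⟩, fun ⟨c⟩ ↦ c.ind fun a ↦ ⟨a⟩⟩

theorem card_connectedComponent_bot :
    Nat.card (⊥ : SimpleGraph V).ConnectedComponent = Nat.card V := by
  refine (Nat.card_congr (Equiv.ofBijective (⊥ : SimpleGraph V).connectedComponentMk
    ⟨fun a b h ↦ ?_, fun c ↦ c.ind fun a ↦ ⟨a, rfl⟩⟩)).symm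
  simpa using ConnectedComponent.exact h

theorem Connected.exists_adj_not_reachable (hG : G.Connected)
    (hH : 1 < Nat.card H.ConnectedComponent) : ∃ x y, G.Adj x y ∧ ¬ H.Reachable x y := by
  by_contra! h
  have hpre : H.Preconnected := fun u v ↦ by
    obtain ⟨p⟩ := hG u v
    induction p with
    | nil => exact .rfl
    | cons hab _ ih => exact (h _ _ hab).trans ih
  have := hpre.subsingleton_connectedComponent
  exact hH.not_ge (Finite.card_le_one_iff_subsingleton.mpr this)

theorem ncard_le_of_forall_exists_eq [Fintype V] {A B : Set (SimpleGraph V)}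
    (f : SimpleGraph V → V → V → SimpleGraph V)
    (h : ∀ H ∈ A, ∃ T ∈ B, ∃ x y, f T x y = H) :
    A.ncard ≤ Fintype.card V ^ 2 * B.ncard := by
  have hsub : A ⊆ (fun p : SimpleGraph V × V × V ↦ f p.1 p.2.1 p.2.2) '' (B ×ˢ Set.univ) := by
    intro H hH
    obtain ⟨T, hT, x, y, rfl⟩ := h H hH
    exact ⟨(T, x, y), ⟨hT, trivial⟩, rfl⟩
  calc A.ncard ≤ _ := Set.ncard_le_ncard hsub
    _ ≤ (B ×ˢ (Set.univ : Set (V × V))).ncard := Set.ncard_image_le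
    _ = Fintype.card V ^ 2 * B.ncard := by
      rw [Set.ncard_prod, Set.ncard_univ, Nat.card_prod, Nat.card_eq_fintype_card, sq, mul_comm]

end SimpleGraph

theorem numSpanningForests_one {V : Type*} [Fintype V] (G : SimpleGraph V) :
    numSpanningForests G 1 = numSpanningTrees G := by
  simp only [numSpanningForests, numSpanningTrees,
    isTree_iff_isAcyclic_and_card_connectedComponent]

theorem numSpanningForests_succ_le {V : Type*} [Fintype V] {G : SimpleGraph V}
    (hG : G.Connected) {k : ℕ} (hk : 1 ≤ k) :
    numSpanningForests G (k + 1) ≤ Fintype.card V ^ 2 * numSpanningForests G k := by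
  refine ncard_le_of_forall_exists_eq (fun T x y ↦ T \ edge x y) ?_
  rintro H ⟨hle, hacyc, hcard⟩
  obtain ⟨x, y, hadj, hreach⟩ := hG.exists_adj_not_reachable (H := H) (by omega)
  refine ⟨H ⊔ edge x y, ⟨sup_le hle ((edge_le_iff _).mpr (.inr hadj)),
    hacyc.sup_edge_of_not_reachable hreach, ?_⟩, x, y, ?_⟩
  · have := card_connectedComponent_sup_edge hreach
    omega
  · rw [sup_sdiff_right_self, sdiff_edge _ fun h ↦ hreach h.reachable]

theorem numSpanningForests_le_succ {V : Type*} [Fintype V] (G : SimpleGraph V)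
    {k : ℕ} (hk : k < Fintype.card V) :
    numSpanningForests G k ≤ Fintype.card V ^ 2 * numSpanningForests G (k + 1) := by
  refine ncard_le_of_forall_exists_eq (fun T x y ↦ T ⊔ edge x y) ?_
  rintro H ⟨hle, hacyc, hcard⟩
  have hne : H ≠ ⊥ := by
    rintro rfl
    rw [card_connectedComponent_bot, Nat.card_eq_fintype_card] at hcard
    omega
  obtain ⟨x, y, hadj⟩ := ne_bot_iff_exists_adj.mp hne
  have hsup : H \ edge x y ⊔ edge x y = H :=
    sdiff_sup_cancel ((edge_le_iff _).mpr (.inr hadj))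
  have hreach : ¬ (H \ edge x y).Reachable x y :=
    isAcyclic_iff_forall_adj_isBridge.mp hacyc hadj
  refine ⟨H \ edge x y, ⟨sdiff_le.trans hle, hacyc.anti sdiff_le, ?_⟩, x, y, hsup⟩
  have := card_connectedComponent_sup_edge hreach
  rw [hsup] at this
  omega

/-- For a connected graph `G` on `N` vertices and `1 ≤ k ≤ N`, the number of
spanning forests of `G` with exactly `k` components is at least `τ(G) / N^(2(k-1))`
and at most `N^(2(k-1)) · τ(G)`. -/
theorem spanning_forests_vs_trees {V : Type*} [Fintype V] (G : SimpleGraph V)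
    (hG : G.Connected) (k : ℕ) (hk : 1 ≤ k) (hkN : k ≤ Fintype.card V) :
    numSpanningTrees G ≤ Fintype.card V ^ (2 * (k - 1)) * numSpanningForests G k ∧
    numSpanningForests G k ≤ Fintype.card V ^ (2 * (k - 1)) * numSpanningTrees G := by
  induction k, hk using Nat.le_induction with
  | base => simp [numSpanningForests_one]
  | succ k hk ih =>
    obtain ⟨ih₁, ih₂⟩ := ih (by omega)
    have hpow : Fintype.card V ^ (2 * (k + 1 - 1)) =
        Fintype.card V ^ (2 * (k - 1)) * Fintype.card V ^ 2 := by
      rw [← pow_add]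
      congr 1
      omega
    rw [hpow]
    constructor
    · calc _ ≤ _ := ih₁
        _ ≤ _ := Nat.mul_le_mul_left _ (numSpanningForests_le_succ G (by omega))
        _ = _ := by ring
    · calc _ ≤ _ := numSpanningForests_succ_le hG hk
        _ ≤ _ := Nat.mul_le_mul_left _ ih₂
        _ = _ := by ring
end

section
/- The number of k-splittable spanning trees of the complete graph K_{kn} equals ((kn)! / ((n!)^k · k!)) · (n^{n-2})^k · n^{2(k-1)} · k^{k-2}. -/
open SimpleGraph

/-- A spanning tree `T` is `k`-splittable into pieces of size `n` if some `k-1` of its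
edges can be removed so that each connected component of the result has `n` vertices. -/
def IsSplittable {V : Type*} [Fintype V] (T : SimpleGraph V) (k n : ℕ) : Prop :=
  ∃ F : Finset (Sym2 V), ↑F ⊆ T.edgeSet ∧ F.card = k - 1 ∧
    ∀ c : (T.deleteEdges ↑F).ConnectedComponent, c.supp.ncard = n

/-- The number of `k`-splittable spanning trees of `G`. -/
noncomputable def numSplittableSpanningTrees {V : Type*} [Fintype V]
    (G : SimpleGraph V) (k n : ℕ) : ℕ :=
  Set.ncard {T : SimpleGraph V | T ≤ G ∧ T.IsTree ∧ IsSplittable T k n}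

open scoped Classical in
/-- The equivalence class of `v`, as a finset. -/
noncomputable def Setoid.classFinset {V : Type*} [Fintype V] (r : Setoid V) (v : V) : Finset V :=
  {w | r v w}

open scoped Classical in
/-- The finset of all equivalence classes. -/
noncomputable def Setoid.classFinsets {V : Type*} [Fintype V] (r : Setoid V) :
    Finset (Finset V) :=
  Finset.univ.image r.classFinset

namespace Setoid

variable {V : Type*} [Fintype V] (r : Setoid V)

@[simp]
lemma mem_classFinset {v w : V} : w ∈ r.classFinset v ↔ r v w := by
  simp [classFinset]

lemma classFinset_eq_iff {u v : V} : r.classFinset u = r.classFinset v ↔ r u v := by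
  refine ⟨fun h ↦ ?_, fun h ↦ ?_⟩
  · rw [← r.mem_classFinset, h, r.mem_classFinset]
  · ext w
    simp only [mem_classFinset]
    exact ⟨fun hw ↦ r.trans (r.symm h) hw, fun hw ↦ r.trans h hw⟩

lemma classFinset_mem (v : V) : r.classFinset v ∈ r.classFinsets := by
  simp [classFinsets]

variable {r} in
lemma exists_classFinset_eq {S : Finset V} (hS : S ∈ r.classFinsets) :
    ∃ v, r.classFinset v = S := by
  simpa [classFinsets] using hS

lemma card_classFinset_pos (v : V) : 0 < (r.classFinset v).card :=
  Finset.card_pos.mpr ⟨v, by simp⟩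

lemma sum_classFinset (f : Finset V → ℚ) :
    ∑ v, f (r.classFinset v) = ∑ S ∈ r.classFinsets, (S.card : ℚ) * f S := by
  classical
  rw [Finset.sum_comp f r.classFinset, classFinsets]
  refine Finset.sum_congr (by congr!) fun S hS ↦ ?_
  obtain ⟨v, rfl⟩ := exists_classFinset_eq hS
  rw [nsmul_eq_mul]
  congr 3
  ext w
  simp only [Finset.mem_filter, Finset.mem_univ, true_and, classFinset_eq_iff, mem_classFinset]
  exact r.comm'

lemma sum_inv_card_classFinset :
    ∑ v, ((r.classFinset v).card : ℚ)⁻¹ = r.classFinsets.card := by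
  rw [r.sum_classFinset (fun S ↦ (S.card : ℚ)⁻¹), Finset.cast_card]
  refine Finset.sum_congr rfl fun S hS ↦ mul_inv_cancel₀ ?_
  obtain ⟨v, rfl⟩ := exists_classFinset_eq hS
  exact_mod_cast (r.card_classFinset_pos v).ne'

variable {r}

lemma card_classFinsets_mul {n : ℕ} (h : ∀ v, (r.classFinset v).card = n) :
    r.classFinsets.card * n = Fintype.card V := by
  rcases isEmpty_or_nonempty V with hV | ⟨⟨v⟩⟩
  · simp [classFinsets]
  have hn : (n : ℚ) ≠ 0 := by
    rw [← h v]
    exact_mod_cast (r.card_classFinset_pos v).ne'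
  have := r.sum_inv_card_classFinset
  simp only [h, Finset.sum_const, Finset.card_univ, nsmul_eq_mul] at this
  rw [← @Nat.cast_inj ℚ, Nat.cast_mul, ← this]
  field_simp

lemma prod_card_classFinsets {n : ℕ} (h : ∀ v, (r.classFinset v).card = n) :
    ∏ S ∈ r.classFinsets, (S.card : ℚ) = (n : ℚ) ^ r.classFinsets.card := by
  refine Finset.prod_eq_pow_card fun S hS ↦ ?_
  obtain ⟨v, rfl⟩ := exists_classFinset_eq hS
  rw [h v]

/-- `r'` arises from `r` by merging the two distinct classes of `u` and `v`. -/
structure IsMerge (r r' : Setoid V) (u v : V) : Prop where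
  not_rel : ¬ r u v
  rel_iff : ∀ x y, r' x y ↔ r x y ∨ (r x u ∧ r v y) ∨ (r x v ∧ r u y)

namespace IsMerge

variable {r' : Setoid V} {u v : V}

lemma disjoint (h : IsMerge r r' u v) : Disjoint (r.classFinset u) (r.classFinset v) := by
  rw [Finset.disjoint_left]
  intro w hu hv
  rw [mem_classFinset] at hu hv
  exact h.not_rel (r.trans hu (r.symm hv))

open scoped Classical in
lemma classFinset_eq (h : IsMerge r r' u v) (x : V) :
    r'.classFinset x = if r u x ∨ r v x then r.classFinset u ∪ r.classFinset v
      else r.classFinset x := by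
  have hs : ∀ {a b}, r a b → r b a := r.symm
  have ht : ∀ {a b c}, r a b → r b c → r a c := r.trans
  split_ifs with hx
  · ext y
    simp only [mem_classFinset, h.rel_iff, Finset.mem_union]
    grind
  · ext y
    simp only [mem_classFinset, h.rel_iff]
    grind

open scoped Classical in
lemma classFinsets_eq (h : IsMerge r r' u v) :
    r'.classFinsets = insert (r.classFinset u ∪ r.classFinset v)
      ((r.classFinsets.erase (r.classFinset u)).erase (r.classFinset v)) := by
  ext S
  simp only [classFinsets, Finset.mem_image, Finset.mem_univ, true_and, h.classFinset_eq,
    Finset.mem_insert, Finset.mem_erase]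
  constructor
  · rintro ⟨x, rfl⟩
    split_ifs with hx
    · exact .inl rfl
    · refine .inr ⟨fun hv ↦ hx (.inr ?_), fun hu ↦ hx (.inl ?_), x, rfl⟩
      · exact r.symm (r.classFinset_eq_iff.mp hv)
      · exact r.symm (r.classFinset_eq_iff.mp hu)
  · rintro (rfl | ⟨hv, hu, x, rfl⟩)
    · exact ⟨u, if_pos (.inl (r.refl u))⟩
    · refine ⟨x, if_neg ?_⟩
      rintro (hx | hx)
      · exact hu (r.classFinset_eq_iff.mpr (r.symm hx))
      · exact hv (r.classFinset_eq_iff.mpr (r.symm hx))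

open scoped Classical in
lemma union_notMem (h : IsMerge r r' u v) :
    r.classFinset u ∪ r.classFinset v ∉
      (r.classFinsets.erase (r.classFinset u)).erase (r.classFinset v) := by
  intro hm
  simp only [classFinsets, Finset.mem_image, Finset.mem_univ, true_and, Finset.mem_erase] at hm
  obtain ⟨-, -, x, hx⟩ := hm
  have hu : u ∈ r.classFinset x := by rw [hx]; simp
  have hv : v ∈ r.classFinset x := by rw [hx]; simp
  rw [mem_classFinset] at hu hv
  exact h.not_rel (r.trans (r.symm hu) hv)

lemma classFinset_ne (h : IsMerge r r' u v) : r.classFinset v ≠ r.classFinset u :=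
  fun e ↦ h.not_rel (r.symm (r.classFinset_eq_iff.mp e))

lemma card_classFinsets (h : IsMerge r r' u v) :
    r'.classFinsets.card + 1 = r.classFinsets.card := by
  classical
  have hv : r.classFinset v ∈ r.classFinsets.erase (r.classFinset u) :=
    Finset.mem_erase.mpr ⟨h.classFinset_ne, r.classFinset_mem v⟩
  rw [h.classFinsets_eq, Finset.card_insert_of_notMem h.union_notMem,
    Finset.card_erase_add_one hv, Finset.card_erase_add_one (r.classFinset_mem u)]

lemma prod_card (h : IsMerge r r' u v) :
    (∏ S ∈ r'.classFinsets, (S.card : ℚ)) *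
        ((r.classFinset u).card * (r.classFinset v).card) =
      (∏ S ∈ r.classFinsets, (S.card : ℚ)) *
        ((r.classFinset u).card + (r.classFinset v).card) := by
  classical
  have hv : r.classFinset v ∈ r.classFinsets.erase (r.classFinset u) :=
    Finset.mem_erase.mpr ⟨h.classFinset_ne, r.classFinset_mem v⟩
  rw [h.classFinsets_eq, Finset.prod_insert h.union_notMem,
    Finset.card_union_of_disjoint h.disjoint,
    ← Finset.mul_prod_erase _ _ (r.classFinset_mem u), ← Finset.mul_prod_erase _ _ hv]
  push_cast
  ring

end IsMerge

end Setoid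

namespace SimpleGraph

variable {V : Type*} {G : SimpleGraph V}

lemma reachable_sup_edge_iff {u v x y : V} (huv : u ≠ v) :
    (G ⊔ edge u v).Reachable x y ↔ G.Reachable x y ∨
      (G.Reachable x u ∧ G.Reachable v y) ∨ (G.Reachable x v ∧ G.Reachable u y) := by
  have ht : ∀ {a b c}, G.Reachable a b → G.Reachable b c → G.Reachable a c := Reachable.trans
  have hs : ∀ {a b}, G.Reachable a b → G.Reachable b a := Reachable.symm
  constructor
  · rintro ⟨p⟩
    induction p with
    | nil => exact .inl (Reachable.refl _)
    | cons h p ih =>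
      rw [sup_adj, edge_adj] at h
      have hr := @Reachable.refl _ G
      rcases h with h | ⟨⟨rfl, rfl⟩ | ⟨rfl, rfl⟩, -⟩
      · have := h.reachable
        grind
      · grind
      · grind
  · have hle : G ≤ G ⊔ edge u v := le_sup_left
    have hadj : (G ⊔ edge u v).Reachable u v :=
      Adj.reachable (by simp [edge_adj, huv])
    rintro (h | ⟨h₁, h₂⟩ | ⟨h₁, h₂⟩)
    · exact h.mono hle
    · exact (h₁.mono hle).trans (hadj.trans (h₂.mono hle))
    · exact (h₁.mono hle).trans (hadj.symm.trans (h₂.mono hle))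

lemma isMerge_sup_edge {u v : V} (h : ¬ G.Reachable u v) :
    G.reachableSetoid.IsMerge (G ⊔ edge u v).reachableSetoid u v :=
  ⟨h, fun _ _ ↦ reachable_sup_edge_iff fun e ↦ h (e ▸ Reachable.refl _)⟩

variable [Fintype V]

open scoped Classical in
lemma IsAcyclic.card_edgeFinset_add_card_classFinsets (hG : G.IsAcyclic) :
    G.edgeFinset.card + G.reachableSetoid.classFinsets.card = Fintype.card V := by
  induction hm : G.edgeFinset.card generalizing G with
  | zero =>
    rw [Finset.card_eq_zero, edgeFinset_eq_empty] at hm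
    subst hm
    rw [zero_add, ← mul_one (Finset.card _)]
    refine Setoid.card_classFinsets_mul fun v ↦ Finset.card_eq_one.mpr ⟨v, ?_⟩
    ext w
    rw [Setoid.mem_classFinset, Finset.mem_singleton]
    exact reachable_bot.trans eq_comm
  | succ m ih =>
    obtain ⟨⟨u, v⟩, he⟩ := Finset.card_pos.mp (show 0 < G.edgeFinset.card by omega)
    have huv : G.Adj u v := mem_edgeFinset.mp he
    have hnr : ¬ (G.deleteEdges {s(u, v)}).Reachable u v :=
      isAcyclic_iff_forall_adj_isBridge.mp hG huv
    have hsup : G.deleteEdges {s(u, v)} ⊔ edge u v = G := by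
      ext x y
      simp only [sup_adj, deleteEdges_adj, Set.mem_singleton_iff, adj_edge]
      have := @Adj.ne _ G x y
      have : s(u, v) = s(x, y) → G.Adj x y := fun h ↦ by
        rwa [← mem_edgeSet, ← h]
      grind
    have hmerge := (isMerge_sup_edge hnr).card_classFinsets
    have hcard := (G.deleteEdges {s(u, v)}).card_edgeFinset_sup_edge
      (fun h ↦ hnr h.reachable) huv.ne
    have hcard' : G.edgeFinset.card = (G.deleteEdges {s(u, v)}).edgeFinset.card + 1 := by
      rw [← hcard]
      congr!
      exact hsup.symm
    rw [hsup] at hmerge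
    have := ih (hG.anti (deleteEdges_le {s(u, v)}))
      (by convert! Nat.succ.inj (hcard'.symm.trans hm))
    omega

open scoped Classical in
lemma card_filter_adj : (Finset.univ.filter fun p : V × V ↦ G.Adj p.1 p.2).card =
    2 * G.edgeFinset.card := by
  rw [← sum_degrees_eq_twice_card_edges, Finset.card_filter, Fintype.sum_prod_type]
  refine Finset.sum_congr rfl fun v _ ↦ ?_
  rw [← Finset.card_filter, ← card_neighborFinset_eq_degree]
  congr 1
  ext
  simp

end SimpleGraph

namespace SimpleGraph

variable {V : Type*}

lemma IsAcyclic.eq_of_le_of_reachable_le {F T : SimpleGraph V} (hT : T.IsAcyclic) (hle : F ≤ T)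
    (h : ∀ u v, T.Reachable u v → F.Reachable u v) : F = T := by
  have hreach : F.Reachable = T.Reachable := by
    ext u v
    exact ⟨.mono hle, h u v⟩
  exact ((maximal_isAcyclic_iff_reachable_eq hle (hT.anti hle)).mpr hreach).eq_of_le
    ⟨le_rfl, hT⟩ hle

lemma not_reachable_of_adj_of_not_adj {F T : SimpleGraph V} (hT : T.IsAcyclic) (hle : F ≤ T)
    {u v : V} (huv : T.Adj u v) (hF : ¬ F.Adj u v) : ¬ F.Reachable u v := by
  intro h
  refine isAcyclic_iff_forall_adj_isBridge.mp hT huv (h.mono fun x y hxy ↦ ?_)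
  rw [deleteEdges_adj, Set.mem_singleton_iff]
  refine ⟨hle hxy, fun e ↦ hF ?_⟩
  rwa [← mem_edgeSet, ← e]

variable [Fintype V]

open scoped Classical in
/-- The forests containing `F` whose components are exactly the classes of `r`. -/
noncomputable def forestsAbove (F : SimpleGraph V) (r : Setoid V) : Finset (SimpleGraph V) :=
  {T | F ≤ T ∧ T.IsAcyclic ∧ T.reachableSetoid = r}

lemma mem_forestsAbove {F T : SimpleGraph V} {r : Setoid V} :
    T ∈ forestsAbove F r ↔ F ≤ T ∧ T.IsAcyclic ∧ T.reachableSetoid = r := by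
  simp [forestsAbove]

end SimpleGraph

lemma Setoid.eq_of_le_of_card_classFinsets_le {V : Type*} [Fintype V] {r s : Setoid V}
    (h : r ≤ s) (hc : r.classFinsets.card ≤ s.classFinsets.card) : r = s := by
  classical
  have hmap : ∀ v, (r.classFinset v).biUnion s.classFinset = s.classFinset v := fun v ↦ by
    ext w
    simp only [Finset.mem_biUnion, mem_classFinset]
    exact ⟨fun ⟨x, hx, hw⟩ ↦ s.trans (h hx) hw, fun hw ↦ ⟨v, r.refl v, hw⟩⟩
  refine le_antisymm h fun u v huv ↦ ?_
  rw [← classFinset_eq_iff]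
  refine Finset.inj_on_of_surj_on_of_card_le (s := r.classFinsets) (t := s.classFinsets)
    (fun S _ ↦ S.biUnion s.classFinset) ?_ ?_ hc (r.classFinset_mem u) (r.classFinset_mem v) ?_
  · intro S hS
    obtain ⟨v, rfl⟩ := exists_classFinset_eq hS
    simpa only [hmap] using s.classFinset_mem v
  · intro S hS
    obtain ⟨v, rfl⟩ := exists_classFinset_eq hS
    exact ⟨_, r.classFinset_mem v, hmap v⟩
  · simpa only [hmap, classFinset_eq_iff] using huv

open scoped Classical in
lemma Setoid.sum_inv_card_add_inv_card {V : Type*} [Fintype V] {r t : Setoid V} {s : ℕ}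
    (hr : ∀ v, (r.classFinset v).card = s) (htr : t ≤ r) :
    ∑ p : V × V with r p.1 p.2 ∧ ¬ t p.1 p.2,
        (((t.classFinset p.1).card : ℚ)⁻¹ + ((t.classFinset p.2).card : ℚ)⁻¹) =
      2 * s * (t.classFinsets.card - r.classFinsets.card) := by
  have hcard : ∀ v, ((Finset.univ.filter fun w ↦ r v w ∧ ¬ t v w).card : ℚ) =
      s - (t.classFinset v).card := fun v ↦ by
    have : (Finset.univ.filter fun w ↦ r v w ∧ ¬ t v w) = r.classFinset v \ t.classFinset v := by
      ext; simp
    rw [this, Finset.cast_card_sdiff, hr]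
    intro w
    simpa using @htr v w
  have hN : (r.classFinsets.card : ℚ) * s = Fintype.card V := mod_cast card_classFinsets_mul hr
  have half : ∑ p : V × V with r p.1 p.2 ∧ ¬ t p.1 p.2, ((t.classFinset p.1).card : ℚ)⁻¹ =
      s * (t.classFinsets.card - r.classFinsets.card) := by
    rw [Finset.sum_filter, Fintype.sum_prod_type]
    simp only [← Finset.sum_filter, Finset.sum_const, nsmul_eq_mul, hcard]
    have : ∀ v, ((s : ℚ) - (t.classFinset v).card) * ((t.classFinset v).card : ℚ)⁻¹ =
        s * ((t.classFinset v).card : ℚ)⁻¹ - 1 := fun v ↦ by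
      have : ((t.classFinset v).card : ℚ) ≠ 0 := mod_cast (t.card_classFinset_pos v).ne'
      field_simp
    simp only [this, Finset.sum_sub_distrib, ← Finset.mul_sum, sum_inv_card_classFinset]
    simp only [Finset.sum_const, Finset.card_univ, nsmul_eq_mul, mul_one, ← hN]
    ring
  have half' : ∑ p : V × V with r p.1 p.2 ∧ ¬ t p.1 p.2, ((t.classFinset p.2).card : ℚ)⁻¹ =
      s * (t.classFinsets.card - r.classFinsets.card) := by
    rw [← half]
    refine Finset.sum_equiv (Equiv.prodComm V V) (fun p ↦ ?_) (fun p _ ↦ rfl)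
    simp only [Finset.mem_filter, Finset.mem_univ, true_and, Equiv.prodComm_apply, Prod.fst_swap,
      Prod.snd_swap]
    rw [r.comm', t.comm']
  rw [Finset.sum_add_distrib, half, half']
  ring

namespace SimpleGraph

variable {V : Type*} [Fintype V]

open scoped Classical in
lemma card_filter_adj_forestsAbove {F T : SimpleGraph V} {r : Setoid V} {m : ℕ}
    (hF : F.IsAcyclic) (hm : F.reachableSetoid.classFinsets.card = m + r.classFinsets.card)
    (hT : T ∈ forestsAbove F r) :
    (Finset.univ.filter fun p : V × V ↦
      (r p.1 p.2 ∧ ¬ F.reachableSetoid p.1 p.2) ∧ T.Adj p.1 p.2).card = 2 * m := by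
  obtain ⟨hle, hac, rfl⟩ := mem_forestsAbove.mp hT
  have h : (Finset.univ.filter fun p : V × V ↦
      (T.reachableSetoid p.1 p.2 ∧ ¬ F.reachableSetoid p.1 p.2) ∧ T.Adj p.1 p.2) =
      (Finset.univ.filter fun p : V × V ↦ T.Adj p.1 p.2) \
        (Finset.univ.filter fun p : V × V ↦ F.Adj p.1 p.2) := by
    ext p
    simp only [Finset.mem_filter, Finset.mem_univ, true_and, Finset.mem_sdiff]
    refine ⟨fun h ↦ ⟨h.2, fun hF ↦ h.1.2 hF.reachable⟩, fun h ↦ ⟨⟨h.1.reachable, ?_⟩, h.1⟩⟩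
    exact not_reachable_of_adj_of_not_adj hac hle h.1 h.2
  rw [h, Finset.card_sdiff_of_subset fun p ↦ by simpa using @hle p.1 p.2, card_filter_adj,
    card_filter_adj]
  have h₁ := hF.card_edgeFinset_add_card_classFinsets
  have h₂ := hac.card_edgeFinset_add_card_classFinsets
  omega

open scoped Classical in
lemma filter_adj_forestsAbove {F : SimpleGraph V} {r : Setoid V} {u v : V}
    (huv : ¬ F.Reachable u v) :
    (forestsAbove F r).filter (fun T ↦ T.Adj u v) = forestsAbove (F ⊔ edge u v) r := by
  have hne : u ≠ v := fun e ↦ huv (e ▸ Reachable.refl _)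
  ext T
  simp only [Finset.mem_filter, mem_forestsAbove, sup_le_iff, edge_le_iff, hne, false_or]
  tauto

/-- If all classes of `r` have `s` elements, then the forests containing a given forest `F` and
having the classes of `r` as components are counted by powers of `s` and the component sizes. -/
theorem card_forestsAbove_mul {r : Setoid V} {s : ℕ} (hr : ∀ v, (r.classFinset v).card = s)
    (m : ℕ) {F : SimpleGraph V} (hF : F.IsAcyclic) (hle : F.reachableSetoid ≤ r)
    (hm : F.reachableSetoid.classFinsets.card = m + r.classFinsets.card) :
    ((forestsAbove F r).card : ℚ) * s ^ r.classFinsets.card =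
      s ^ m * ∏ S ∈ F.reachableSetoid.classFinsets, (S.card : ℚ) := by
  classical
  induction m generalizing F with
  | zero =>
    have heq : F.reachableSetoid = r :=
      Setoid.eq_of_le_of_card_classFinsets_le hle (by omega)
    have : forestsAbove F r = {F} := by
      ext T
      rw [mem_forestsAbove, Finset.mem_singleton]
      refine ⟨fun ⟨hFT, hT, h⟩ ↦ ?_, by rintro rfl; exact ⟨le_rfl, hF, heq⟩⟩
      refine (hT.eq_of_le_of_reachable_le hFT fun u v huv ↦ ?_).symm
      have : T.reachableSetoid u v := huv
      rwa [h, ← heq] at this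
    rw [this, heq, Setoid.prod_card_classFinsets hr]
    simp
  | succ m ih =>
    set t := F.reachableSetoid with ht
    have hstep : ∀ p ∈ Finset.univ.filter fun p : V × V ↦ r p.1 p.2 ∧ ¬ t p.1 p.2,
        (((forestsAbove F r).filter fun T ↦ T.Adj p.1 p.2).card : ℚ) * s ^ r.classFinsets.card =
          s ^ m * (∏ S ∈ t.classFinsets, (S.card : ℚ)) *
            (((t.classFinset p.1).card : ℚ)⁻¹ + ((t.classFinset p.2).card : ℚ)⁻¹) := by
      rintro ⟨u, v⟩ hp
      simp only [Finset.mem_filter, Finset.mem_univ, true_and] at hp ⊢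
      obtain ⟨hruv, htuv⟩ := hp
      have hmerge := isMerge_sup_edge htuv
      rw [filter_adj_forestsAbove htuv]
      rw [ih (hF.sup_edge_of_not_reachable htuv)]
      · have hu : ((t.classFinset u).card : ℚ) ≠ 0 := mod_cast (t.card_classFinset_pos u).ne'
        have hv : ((t.classFinset v).card : ℚ) ≠ 0 := mod_cast (t.card_classFinset_pos v).ne'
        have := hmerge.prod_card
        rw [← ht] at this
        field_simp
        linear_combination (s : ℚ) ^ m * this
      · intro x y hxy
        rcases (hmerge.rel_iff x y).mp hxy with h | ⟨h₁, h₂⟩ | ⟨h₁, h₂⟩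
        · exact hle h
        · exact r.trans (hle h₁) (r.trans hruv (hle h₂))
        · exact r.trans (hle h₁) (r.trans (r.symm hruv) (hle h₂))
      · have := hmerge.card_classFinsets
        rw [← ht] at this
        omega
    have hdouble := Finset.sum_card_bipartiteAbove_eq_sum_card_bipartiteBelow
      (s := forestsAbove F r)
      (t := Finset.univ.filter fun p : V × V ↦ r p.1 p.2 ∧ ¬ t p.1 p.2)
      (fun T p ↦ T.Adj p.1 p.2)
    simp only [Finset.bipartiteAbove, Finset.bipartiteBelow, Finset.filter_filter] at hdouble
    rw [Finset.sum_congr rfl fun T hT ↦ card_filter_adj_forestsAbove hF hm hT, Finset.sum_const,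
      smul_eq_mul] at hdouble
    have hsum := Finset.sum_congr rfl hstep
    rw [← Finset.sum_mul, ← Finset.mul_sum, Setoid.sum_inv_card_add_inv_card hr hle, hm,
      ← Nat.cast_sum, ← hdouble] at hsum
    push_cast at hsum
    have : (2 * ((m : ℚ) + 1)) ≠ 0 := by positivity
    refine mul_left_cancel₀ this ?_
    rw [pow_succ]
    linear_combination hsum

end SimpleGraph

namespace Setoid

variable {V : Type*} {k n : ℕ}

/-- Labelling the classes of `r` and the elements of each class labels all of `V`. -/
noncomputable def labelEquiv (r : Setoid V)
    (e : (Quotient r ≃ Fin k) × ∀ c : Quotient r, {v // Quotient.mk r v = c} ≃ Fin n) :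
    V ≃ Fin k × Fin n :=
  (Equiv.sigmaFiberEquiv (Quotient.mk r)).symm.trans
    ((Equiv.sigmaCongr e.1 e.2).trans (Equiv.sigmaEquivProd (Fin k) (Fin n)))

lemma labelEquiv_apply (r : Setoid V)
    (e : (Quotient r ≃ Fin k) × ∀ c : Quotient r, {v // Quotient.mk r v = c} ≃ Fin n) (v : V) :
    labelEquiv r e v = (e.1 (Quotient.mk r v), e.2 _ ⟨v, rfl⟩) := rfl

lemma labelEquiv_injective (r : Setoid V) :
    Function.Injective (labelEquiv (k := k) (n := n) r) := by
  rintro ⟨e, f⟩ ⟨e', f'⟩ h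
  have h' : ∀ v, (e (Quotient.mk r v), f _ ⟨v, rfl⟩) = (e' (Quotient.mk r v), f' _ ⟨v, rfl⟩) :=
    fun v ↦ congrArg (fun σ : V ≃ Fin k × Fin n ↦ σ v) h
  simp only [Prod.mk.injEq] at h' ⊢
  constructor
  · ext c
    induction c using Quotient.inductionOn with
    | h v => rw [(h' v).1]
  · ext c ⟨v, rfl⟩
    rw [(h' v).2]

lemma ker_labelEquiv (r : Setoid V)
    (e : (Quotient r ≃ Fin k) × ∀ c : Quotient r, {v // Quotient.mk r v = c} ≃ Fin n) :
    Setoid.ker (fun v ↦ (labelEquiv r e v).1) = r := by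
  ext x y
  simp only [Setoid.ker_def, labelEquiv_apply, EmbeddingLike.apply_eq_iff_eq]
  exact Quotient.eq

lemma exists_labelEquiv_eq (σ : V ≃ Fin k × Fin n) (hn : n ≠ 0) :
    ∃ e, labelEquiv (Setoid.ker (fun v ↦ (σ v).1)) e = σ := by
  set r := Setoid.ker (fun v ↦ (σ v).1) with hr
  have hrel : ∀ x y, Quotient.mk r x = Quotient.mk r y ↔ (σ x).1 = (σ y).1 :=
    fun x y ↦ Quotient.eq
  let φ : Quotient r → Fin k := Quotient.lift (fun v ↦ (σ v).1) fun x y h ↦ h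
  have hφ : Function.Bijective φ := by
    constructor
    · intro c d
      induction c, d using Quotient.inductionOn₂ with
      | h x y => exact (hrel x y).mpr
    · intro i
      refine ⟨Quotient.mk r (σ.symm (i, ⟨0, Nat.pos_of_ne_zero hn⟩)), ?_⟩
      change (σ (σ.symm _)).1 = i
      rw [σ.apply_symm_apply]
  let ψ : ∀ c : Quotient r, {v // Quotient.mk r v = c} → Fin n := fun c v ↦ (σ v).2
  have hψ : ∀ c, Function.Bijective (ψ c) := by
    intro c
    constructor
    · rintro ⟨x, hx⟩ ⟨y, hy⟩ h
      exact Subtype.ext (σ.injective (Prod.ext ((hrel x y).mp (hx.trans hy.symm)) h))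
    · intro i
      induction c using Quotient.inductionOn with
      | h v =>
        refine ⟨⟨σ.symm ((σ v).1, i), (hrel _ _).mpr ?_⟩, ?_⟩
        · rw [σ.apply_symm_apply]
        · change (σ (σ.symm _)).2 = i
          rw [σ.apply_symm_apply]
  exact ⟨(Equiv.ofBijective φ hφ, fun c ↦ Equiv.ofBijective (ψ c) (hψ c)), Equiv.ext fun _ ↦ rfl⟩

variable [Fintype V]

open scoped Classical in
noncomputable instance : Fintype (Setoid V) :=
  Fintype.ofInjective (fun r : Setoid V ↦ fun p : V × V ↦ r p.1 p.2) fun r s h ↦ by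
    ext x y
    exact iff_of_eq (congrFun h (x, y))

open scoped Classical in
/-- The equivalence relations all of whose classes have `n` elements. -/
noncomputable def uniform (V : Type*) [Fintype V] (n : ℕ) : Finset (Setoid V) :=
  {r | ∀ v, (r.classFinset v).card = n}

lemma mem_uniform {r : Setoid V} : r ∈ uniform V n ↔ ∀ v, (r.classFinset v).card = n := by
  simp [uniform]

lemma card_fiber_quotient {r : Setoid V} (hr : r ∈ uniform V n) (c : Quotient r) :
    Nat.card {v // Quotient.mk r v = c} = n := by
  classical
  induction c using Quotient.inductionOn with
  | h v =>
    rw [← mem_uniform.mp hr v, Nat.card_eq_fintype_card, Fintype.card_subtype]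
    congr 1
    ext w
    simp only [Finset.mem_filter, Finset.mem_univ, true_and, mem_classFinset]
    exact Quotient.eq.trans r.comm'

lemma card_quotient {r : Setoid V} (hr : r ∈ uniform V n) :
    Nat.card (Quotient r) * n = Fintype.card V := by
  classical
  rw [← Nat.card_eq_fintype_card, ← Nat.card_congr (Equiv.sigmaFiberEquiv (Quotient.mk r)),
    Nat.card_sigma, Finset.sum_congr rfl fun c _ ↦ card_fiber_quotient hr c]
  simp

lemma ker_mem_uniform (σ : V ≃ Fin k × Fin n) :
    Setoid.ker (fun v ↦ (σ v).1) ∈ uniform V n := by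
  classical
  refine mem_uniform.mpr fun v ↦ ?_
  have : (Setoid.ker (fun v ↦ (σ v).1)).classFinset v =
      Finset.univ.map ⟨fun i : Fin n ↦ σ.symm ((σ v).1, i),
        σ.symm.injective.comp (Prod.mk_right_injective _)⟩ := by
    ext w
    simp only [mem_classFinset, ker_def, Finset.mem_map, Finset.mem_univ, true_and,
      Function.Embedding.coeFn_mk]
    refine ⟨fun h ↦ ⟨(σ w).2, by rw [h, Prod.mk.eta, σ.symm_apply_apply]⟩, ?_⟩
    rintro ⟨i, rfl⟩
    rw [σ.apply_symm_apply]
  rw [this, Finset.card_map, Finset.card_univ, Fintype.card_fin]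

/-- The number of ways to split a set of `k * n` elements into `k` unordered blocks of size `n`. -/
theorem card_uniform_mul (hV : Fintype.card V = k * n) (hn : n ≠ 0) :
    (uniform V n).card * (k.factorial * n.factorial ^ k) = (k * n).factorial := by
  classical
  have hσ : Fintype.card (V ≃ Fin k × Fin n) = (k * n).factorial := by
    rw [Fintype.card_equiv (Fintype.equivOfCardEq (by simp [hV])), hV]
  rw [← hσ, ← Finset.card_univ, Finset.card_eq_sum_card_fiberwise
    (f := fun σ : V ≃ Fin k × Fin n ↦ Setoid.ker (fun v ↦ (σ v).1)) (t := uniform V n)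
    (fun σ _ ↦ ker_mem_uniform σ)]
  refine (Finset.sum_const_nat fun r hr ↦ ?_).symm
  have hfiber : (Finset.univ.filter fun σ : V ≃ Fin k × Fin n ↦
      Setoid.ker (fun v ↦ (σ v).1) = r) = Finset.univ.map ⟨_, labelEquiv_injective r⟩ := by
    ext σ
    simp only [Finset.mem_filter, Finset.mem_univ, true_and, Finset.mem_map,
      Function.Embedding.coeFn_mk]
    constructor
    · rintro rfl
      exact exists_labelEquiv_eq σ hn
    · rintro ⟨e, rfl⟩
      exact ker_labelEquiv r e
  have hq : Fintype.card (Quotient r) = k := by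
    rw [← Nat.card_eq_fintype_card]
    exact Nat.eq_of_mul_eq_mul_right (Nat.pos_of_ne_zero hn) ((card_quotient hr).trans hV)
  have hc : ∀ c : Quotient r, Fintype.card {v // Quotient.mk r v = c} = n := fun c ↦ by
    rw [← Nat.card_eq_fintype_card, card_fiber_quotient hr]
  rw [hfiber, Finset.card_map, Finset.card_univ, Fintype.card_prod, Fintype.card_pi,
    Fintype.card_equiv (Fintype.equivOfCardEq (by simp [hq])), hq]
  congr 1
  rw [Finset.prod_congr rfl fun c _ ↦
    (Fintype.card_equiv (Fintype.equivOfCardEq (by simp [hc c]))).trans (by rw [hc c]),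
    Finset.prod_const, Finset.card_univ, hq]

end Setoid

namespace SimpleGraph

variable {V : Type*} [Fintype V] {k n : ℕ}

lemma dvd_card_of_adj_closed {G : SimpleGraph V}
    (hG : ∀ v, (G.reachableSetoid.classFinset v).card = n) {S : Finset V}
    (hS : ∀ ⦃x y⦄, x ∈ S → G.Adj x y → y ∈ S) : n ∣ S.card := by
  classical
  have hclosed : ∀ ⦃x y⦄, G.Reachable x y → x ∈ S → y ∈ S := by
    rintro x y ⟨p⟩
    induction p with
    | nil => exact id
    | cons h _ ih => exact fun hx ↦ ih (hS hx h)
  rw [Finset.card_eq_sum_card_image G.reachableSetoid.classFinset S]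
  refine Finset.dvd_sum fun C hC ↦ ?_
  obtain ⟨x, hx, rfl⟩ := Finset.mem_image.mp hC
  have : (S.filter fun y ↦ G.reachableSetoid.classFinset y = G.reachableSetoid.classFinset x) =
      G.reachableSetoid.classFinset x := by
    ext y
    rw [Finset.mem_filter, Setoid.classFinset_eq_iff, Setoid.mem_classFinset]
    exact ⟨fun h ↦ h.2.symm, fun h ↦ ⟨hclosed h hx, h.symm⟩⟩
  rw [this, hG]

lemma le_of_uniform_of_uniform {F₁ F₂ T : SimpleGraph V} (hT : T.IsAcyclic) (h₁ : F₁ ≤ T)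
    (h₂ : F₂ ≤ T) (hF₁ : F₁.reachableSetoid ∈ Setoid.uniform V n)
    (hF₂ : F₂.reachableSetoid ∈ Setoid.uniform V n) : F₁ ≤ F₂ := by
  classical
  rw [Setoid.mem_uniform] at hF₁ hF₂
  intro u v huv
  by_contra hnot
  set T' := T.deleteEdges {s(u, v)} with hT'
  have hbridge : ¬ T'.Reachable u v := isAcyclic_iff_forall_adj_isBridge.mp hT (h₁ huv)
  set A := T'.reachableSetoid.classFinset u
  set C := F₁.reachableSetoid.classFinset u
  have hA : ∀ x, x ∈ A ↔ T'.Reachable u x := fun x ↦ Setoid.mem_classFinset _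
  have hC : ∀ x, x ∈ C ↔ F₁.Reachable u x := fun x ↦ Setoid.mem_classFinset _
  have hdvdA : n ∣ A.card := by
    refine dvd_card_of_adj_closed hF₂ fun x y hx hxy ↦ ?_
    rw [hA] at hx ⊢
    refine hx.trans (Adj.reachable ?_)
    rw [hT', deleteEdges_adj, Set.mem_singleton_iff]
    refine ⟨h₂ hxy, fun e ↦ hnot ?_⟩
    rwa [← mem_edgeSet, ← e]
  have hdvdAC : n ∣ (A \ C).card := by
    refine dvd_card_of_adj_closed hF₁ fun x y hx hxy ↦ ?_
    rw [Finset.mem_sdiff, hA, hC] at hx ⊢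
    refine ⟨hx.1.trans (Adj.reachable ?_), fun h ↦ hx.2 (h.trans hxy.symm.reachable)⟩
    rw [hT', deleteEdges_adj, Set.mem_singleton_iff]
    refine ⟨h₁ hxy, fun e ↦ hx.2 ?_⟩
    rcases Sym2.eq_iff.mp e with ⟨rfl, -⟩ | ⟨rfl, -⟩
    · exact Reachable.refl _
    · exact huv.reachable
  have hdvd : n ∣ (A ∩ C).card := by
    rw [← Finset.card_sdiff_add_card_inter A C] at hdvdA
    exact (Nat.dvd_add_right hdvdAC).mp hdvdA
  have hpos : 0 < (A ∩ C).card := Finset.card_pos.mpr ⟨u, by simp [hA, hC]⟩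
  have hlt : (A ∩ C).card < C.card := by
    refine Finset.card_lt_card ⟨Finset.inter_subset_right, fun h ↦ hbridge ?_⟩
    rw [← hA]
    exact (Finset.mem_inter.mp (h ((hC v).mpr huv.reachable))).1
  rw [hF₁] at hlt
  exact absurd (Nat.le_of_dvd hpos hdvd) hlt.not_ge

lemma ncard_supp_connectedComponentMk (G : SimpleGraph V) (v : V) :
    (G.connectedComponentMk v).supp.ncard = (G.reachableSetoid.classFinset v).card := by
  rw [← Set.ncard_coe_finset]
  congr 1
  ext w
  rw [ConnectedComponent.mem_supp_iff, ConnectedComponent.eq, Finset.mem_coe,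
    Setoid.mem_classFinset]
  exact reachable_comm

lemma forall_ncard_supp_eq_iff {G : SimpleGraph V} :
    (∀ c : G.ConnectedComponent, c.supp.ncard = n) ↔
      G.reachableSetoid ∈ Setoid.uniform V n := by
  rw [Setoid.mem_uniform]
  refine ⟨fun h v ↦ by rw [← ncard_supp_connectedComponentMk, h], fun h c ↦ ?_⟩
  induction c using ConnectedComponent.ind with
  | h v => rw [ncard_supp_connectedComponentMk, h]

lemma card_classFinsets_of_mem_uniform {r : Setoid V} (hV : Fintype.card V = k * n) (hn : n ≠ 0)
    (hr : r ∈ Setoid.uniform V n) : r.classFinsets.card = k :=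
  Nat.eq_of_mul_eq_mul_right (Nat.pos_of_ne_zero hn)
    ((Setoid.card_classFinsets_mul (Setoid.mem_uniform.mp hr)).trans hV)

lemma IsTree.isSplittable_iff {T : SimpleGraph V} (hT : T.IsTree)
    (hV : Fintype.card V = k * n) (hn : n ≠ 0) :
    IsSplittable T k n ↔ ∃ F ≤ T, F.reachableSetoid ∈ Setoid.uniform V n := by
  classical
  constructor
  · rintro ⟨E, -, -, h⟩
    exact ⟨T.deleteEdges E, deleteEdges_le _, forall_ncard_supp_eq_iff.mp h⟩
  · rintro ⟨F, hle, hF⟩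
    have hdel : T.deleteEdges ↑(T.edgeFinset \ F.edgeFinset) = F := by
      ext x y
      simp only [deleteEdges_adj, Finset.coe_sdiff, coe_edgeFinset, Set.mem_sdiff, mem_edgeSet]
      have := @hle x y
      tauto
    refine ⟨T.edgeFinset \ F.edgeFinset, by simp, ?_, ?_⟩
    · rw [Finset.card_sdiff_of_subset (edgeFinset_mono hle)]
      have h₁ := hT.card_edgeFinset
      have h₂ := (hT.isAcyclic.anti hle).card_edgeFinset_add_card_classFinsets
      rw [card_classFinsets_of_mem_uniform hV hn hF] at h₂
      omega
    · rw [hdel]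
      exact forall_ncard_supp_eq_iff.mpr hF

end SimpleGraph

section Count

variable {V : Type*} [Fintype V] {k n : ℕ}

open scoped Classical in
/-- The spanning forests all of whose components have `n` vertices. -/
noncomputable def uniformForests (V : Type*) [Fintype V] (n : ℕ) : Finset (SimpleGraph V) :=
  {F | F.IsAcyclic ∧ F.reachableSetoid ∈ Setoid.uniform V n}

lemma mem_uniformForests {F : SimpleGraph V} :
    F ∈ uniformForests V n ↔ F.IsAcyclic ∧ F.reachableSetoid ∈ Setoid.uniform V n := by
  simp [uniformForests]

lemma mem_forestsAbove_top [Nonempty V] {F T : SimpleGraph V} :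
    T ∈ forestsAbove F ⊤ ↔ F ≤ T ∧ T.IsTree := by
  rw [mem_forestsAbove, isTree_iff, and_comm (a := T.Connected)]
  refine and_congr_right fun _ ↦ and_congr_right fun _ ↦ ?_
  refine ⟨fun h ↦ ⟨fun u v ↦ ?_⟩, fun h ↦ ?_⟩
  · have : (⊤ : Setoid V) u v := trivial
    rwa [← h] at this
  · ext u v
    exact iff_of_true (h.preconnected u v) trivial

lemma card_forestsAbove_top_mul (hV : Fintype.card V = k * n) (hk : k ≠ 0) (hn : n ≠ 0)
    {F : SimpleGraph V} (hF : F ∈ uniformForests V n) :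
    ((forestsAbove F ⊤).card : ℚ) * (k * n) = (k * n) ^ (k - 1) * n ^ k := by
  obtain ⟨hac, hunif⟩ := mem_uniformForests.mp hF
  have htop : (⊤ : Setoid V) ∈ Setoid.uniform V (k * n) := by
    refine Setoid.mem_uniform.mpr fun v ↦ ?_
    rw [← hV, ← Finset.card_univ]
    congr 1
    ext w
    simp
  have hone : (⊤ : Setoid V).classFinsets.card = 1 :=
    card_classFinsets_of_mem_uniform (by rw [hV, one_mul]) (by positivity) htop
  have hkcard := card_classFinsets_of_mem_uniform hV hn hunif
  have := card_forestsAbove_mul (Setoid.mem_uniform.mp htop) (k - 1) hac le_top (by omega)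
  rw [Setoid.prod_card_classFinsets (Setoid.mem_uniform.mp hunif), hone, hkcard] at this
  simpa using this

lemma card_forestsAbove_bot_mul (hV : Fintype.card V = k * n) (hn : n ≠ 0) {r : Setoid V}
    (hr : r ∈ Setoid.uniform V n) :
    ((forestsAbove ⊥ r).card : ℚ) * n ^ k = n ^ (k * n - k) := by
  have hbot : (⊥ : SimpleGraph V).reachableSetoid ∈ Setoid.uniform V 1 := by
    refine Setoid.mem_uniform.mpr fun v ↦ Finset.card_eq_one.mpr ⟨v, ?_⟩
    ext w
    rw [Setoid.mem_classFinset, Finset.mem_singleton]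
    exact reachable_bot.trans eq_comm
  have hcard := card_classFinsets_of_mem_uniform hV hn hr
  have hcard' := card_classFinsets_of_mem_uniform (k := k * n) (by rw [hV, mul_one]) one_ne_zero hbot
  have hle : k ≤ k * n := Nat.le_mul_of_pos_right k (Nat.pos_of_ne_zero hn)
  have hbr : (⊥ : SimpleGraph V).reachableSetoid ≤ r := fun x y h ↦ by
    obtain rfl := reachable_bot.mp h
    exact r.refl x
  have := card_forestsAbove_mul (Setoid.mem_uniform.mp hr) (k * n - k) isAcyclic_bot hbr (by omega)
  rw [Setoid.prod_card_classFinsets (Setoid.mem_uniform.mp hbot), hcard] at this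
  simpa using this

lemma card_uniformForests_mul (hV : Fintype.card V = k * n) (hn : n ≠ 0) :
    ((uniformForests V n).card : ℚ) * n ^ k = (Setoid.uniform V n).card * n ^ (k * n - k) := by
  classical
  have : uniformForests V n = (Setoid.uniform V n).biUnion (forestsAbove ⊥) := by
    ext F
    simp [mem_uniformForests, mem_forestsAbove, and_comm]
  rw [this, Finset.card_biUnion, Nat.cast_sum, Finset.sum_mul,
    Finset.sum_congr rfl fun r hr ↦ card_forestsAbove_bot_mul hV hn hr, Finset.sum_const,
    nsmul_eq_mul]
  intro r _ s _ hrs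
  refine Finset.disjoint_left.mpr ?_
  intro F hr hs
  exact hrs ((mem_forestsAbove.mp hr).2.2.symm.trans (mem_forestsAbove.mp hs).2.2)

lemma numSplittableSpanningTrees_top_eq_sum (hV : Fintype.card V = k * n) (hk : k ≠ 0)
    (hn : n ≠ 0) :
    numSplittableSpanningTrees (⊤ : SimpleGraph V) k n =
      ∑ F ∈ uniformForests V n, (forestsAbove F ⊤).card := by
  classical
  have : Nonempty V := Fintype.card_pos_iff.mp (by rw [hV]; positivity)
  rw [← Finset.card_biUnion, ← Set.ncard_coe_finset, numSplittableSpanningTrees]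
  · congr 1
    ext T
    simp only [le_top, true_and, Set.mem_ofPred_eq, Finset.coe_biUnion, Set.mem_iUnion,
      Finset.mem_coe, mem_forestsAbove_top, mem_uniformForests, exists_prop]
    constructor
    · rintro ⟨hT, hs⟩
      obtain ⟨F, hle, hF⟩ := (hT.isSplittable_iff hV hn).mp hs
      exact ⟨F, ⟨hT.isAcyclic.anti hle, hF⟩, hle, hT⟩
    · rintro ⟨F, ⟨-, hF⟩, hle, hT⟩
      exact ⟨hT, (hT.isSplittable_iff hV hn).mpr ⟨F, hle, hF⟩⟩
  · intro F₁ hF₁ F₂ hF₂ hne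
    refine Finset.disjoint_left.mpr ?_
    intro T h₁ h₂
    obtain ⟨hle₁, hT⟩ := mem_forestsAbove_top.mp h₁
    obtain ⟨hle₂, -⟩ := mem_forestsAbove_top.mp h₂
    have hu₁ := (mem_uniformForests.mp hF₁).2
    have hu₂ := (mem_uniformForests.mp hF₂).2
    exact hne (le_antisymm (le_of_uniform_of_uniform hT.isAcyclic hle₁ hle₂ hu₁ hu₂)
      (le_of_uniform_of_uniform hT.isAcyclic hle₂ hle₁ hu₂ hu₁))

lemma pow_sub_two_mul_self {a : ℕ} (ha : a ≠ 0) : (a : ℚ) ^ (a - 2) * a = a ^ (a - 1) := by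
  match a with
  | 0 => exact absurd rfl ha
  | 1 => simp
  | a + 2 => simp [pow_succ]

/-- The number of `k`-splittable spanning trees of the complete graph on `k * n` vertices, for an
arbitrary vertex type. -/
theorem numSplittableSpanningTrees_top (hV : Fintype.card V = k * n) (hk : k ≠ 0) (hn : n ≠ 0) :
    (numSplittableSpanningTrees (⊤ : SimpleGraph V) k n : ℚ) =
      (Nat.factorial (k * n) : ℚ) / ((Nat.factorial n : ℚ) ^ k * Nat.factorial k) *
        ((n : ℚ) ^ (n - 2)) ^ k * (n : ℚ) ^ (2 * (k - 1)) * (k : ℚ) ^ (k - 2) := by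
  have hk' : (k : ℚ) ≠ 0 := mod_cast hk
  have hn' : (n : ℚ) ≠ 0 := mod_cast hn
  have hM : (numSplittableSpanningTrees (⊤ : SimpleGraph V) k n : ℚ) * (k * n) =
      (Setoid.uniform V n).card * n ^ (k * n - k) * (k * n) ^ (k - 1) := by
    rw [numSplittableSpanningTrees_top_eq_sum hV hk hn, Nat.cast_sum, Finset.sum_mul,
      Finset.sum_congr rfl fun F hF ↦ card_forestsAbove_top_mul hV hk hn hF, Finset.sum_const,
      nsmul_eq_mul, ← card_uniformForests_mul hV hn]
    ring
  have hU : (Nat.factorial (k * n) : ℚ) / ((Nat.factorial n : ℚ) ^ k * Nat.factorial k) =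
      (Setoid.uniform V n).card := by
    rw [← Setoid.card_uniform_mul hV hn]
    push_cast
    field_simp
  have hpow : (n : ℚ) ^ (k * n - k) = (n ^ (n - 2) * n) ^ k := by
    rw [pow_sub_two_mul_self hn, ← pow_mul, Nat.sub_mul, one_mul, mul_comm]
  refine mul_right_cancel₀ (mul_ne_zero hk' hn') ?_
  have hkpow := pow_sub_two_mul_self hk
  obtain ⟨j, rfl⟩ := Nat.exists_eq_succ_of_ne_zero hk
  simp only [Nat.succ_eq_add_one, Nat.add_sub_cancel] at hkpow hM hpow ⊢
  rw [hM, hU, hpow, mul_pow _ _ j, ← hkpow]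
  ring

end Count

/-- The number of `k`-splittable spanning trees of the complete graph
`K_{kn}` equals `((kn)! / ((n!)^k · k!)) · (n^(n-2))^k · n^(2(k-1)) · k^(k-2)`. -/
theorem complete_graph_splittable_count (k n : ℕ) (hk : 1 ≤ k) (hn : 1 ≤ n) :
    (numSplittableSpanningTrees (⊤ : SimpleGraph (Fin (k * n))) k n : ℚ) =
      (Nat.factorial (k * n) : ℚ) / ((Nat.factorial n : ℚ) ^ k * Nat.factorial k) *
        ((n : ℚ) ^ (n - 2)) ^ k * (n : ℚ) ^ (2 * (k - 1)) * (k : ℚ) ^ (k - 2) := by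
  exact numSplittableSpanningTrees_top (by simp) (by omega) (by omega)
end

section
/- For fixed k ≥ 2, the probability that a uniformly random spanning tree of K_{kn} is 2-splittable, in the case k = 2, equals (2n)! · n^{2n-2} / ((n!)^2 · 2 · (2n)^{2n-2}), and this quantity is asymptotic to (e/√(2π))^2 · n^{-1/2} · (a bounded constant factor) as n → ∞; in particular it is at least c · n^{-1/2} for some constant c > 0 and all sufficiently large n. -/
open SimpleGraph

/-- The probability that a uniformly random spanning tree of `K_{2n}` is 2-splittable. -/
noncomputable def splitProb (n : ℕ) : ℝ :=
  (numSplittableSpanningTrees (⊤ : SimpleGraph (Fin (2 * n))) 2 n : ℝ) /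
    (numSpanningTrees (⊤ : SimpleGraph (Fin (2 * n))) : ℝ)

/-- A map sending edges of `G` to pairs connected in `H` preserves reachability. -/
theorem SimpleGraph.Reachable.of_forall_adj {V W : Type*} {G : SimpleGraph V} {H : SimpleGraph W}
    (f : V → W) (h : ∀ x y, G.Adj x y → H.Reachable (f x) (f y)) {x y : V}
    (hxy : G.Reachable x y) : H.Reachable (f x) (f y) := by
  obtain ⟨p⟩ := hxy
  induction p with
  | nil => rfl
  | cons hadj _ ih => exact (h _ _ hadj).trans ih

/-- A set of vertices closed under adjacency is closed under reachability. -/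
theorem SimpleGraph.Reachable.mem_of_forall_adj {V : Type*} {G : SimpleGraph V} {S : Set V}
    (h : ∀ x y, G.Adj x y → x ∈ S → y ∈ S) {x y : V}
    (hxy : G.Reachable x y) (hx : x ∈ S) : y ∈ S := by
  obtain ⟨p⟩ := hxy
  induction p with
  | nil => exact hx
  | cons hadj _ ih => exact ih (h _ _ hadj hx)

/-- `T.IsCut S a b` says that the only edge of `T` between `S` and its complement is `ab`, with
`a ∈ S`. -/
structure SimpleGraph.IsCut {V : Type*} (T : SimpleGraph V) (S : Set V) (a b : V) : Prop where
  left_mem : a ∈ S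
  right_notMem : b ∉ S
  adj : T.Adj a b
  eq_of_adj : ∀ x y, x ∈ S → y ∉ S → T.Adj x y → x = a ∧ y = b

namespace SimpleGraph

variable {V : Type*} {T : SimpleGraph V} {S : Set V} {a b : V}

theorem IsCut.compl (h : T.IsCut S a b) : T.IsCut Sᶜ b a where
  left_mem := h.right_notMem
  right_notMem := fun hn => hn h.left_mem
  adj := h.adj.symm
  eq_of_adj x y hx hy hxy := (h.eq_of_adj y x (by simpa using hy) hx hxy.symm).symm

theorem IsCut.reachable_induce (h : T.IsCut S a b) (H : SimpleGraph V) (hH : H ≤ T) {x y : V}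
    (hx : x ∈ S) (hy : y ∈ S) (hxy : H.Reachable x y) :
    (H.induce S).Reachable ⟨x, hx⟩ ⟨y, hy⟩ := by
  classical
  have key := hxy.of_forall_adj (H := H.induce S)
    (fun v => if hv : v ∈ S then ⟨v, hv⟩ else ⟨a, h.left_mem⟩) (fun u v huv => by
      by_cases hu : u ∈ S <;> by_cases hv : v ∈ S
      · simpa [hu, hv] using Adj.reachable (by simpa using huv)
      · obtain ⟨rfl, -⟩ := h.eq_of_adj u v hu hv (hH huv)
        simp [hu, hv]
      · obtain ⟨rfl, -⟩ := h.eq_of_adj v u hv hu (hH huv).symm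
        simp [hu, hv]
      · simp [hu, hv])
  simpa [hx, hy] using key

theorem IsCut.connected_induce (h : T.IsCut S a b) (hT : T.Connected) :
    (T.induce S).Connected := by
  have : Nonempty S := ⟨⟨a, h.left_mem⟩⟩
  exact ⟨fun x y => h.reachable_induce T le_rfl x.2 y.2 (hT.preconnected x y)⟩

theorem IsCut.not_reachable (h : T.IsCut S a b) :
    ¬ (T.deleteEdges {s(a, b)}).Reachable a b := fun hr =>
  h.right_notMem <| hr.mem_of_forall_adj (fun x y hxy hx => by
    by_contra hy
    rw [deleteEdges_adj] at hxy
    obtain ⟨rfl, rfl⟩ := h.eq_of_adj x y hx hy hxy.1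
    exact hxy.2 rfl) h.left_mem

theorem IsCut.isBridge_of_mem (h : T.IsCut S a b) (hS : (T.induce S).IsAcyclic) {u v : V}
    (hu : u ∈ S) (hv : v ∈ S) (huv : T.Adj u v) : T.IsBridge s(u, v) := by
  rw [isBridge_iff]
  intro hr
  have hr' := h.reachable_induce _ (deleteEdges_le _) hu hv hr
  have hb := isAcyclic_iff_forall_adj_isBridge.1 hS (v := ⟨u, hu⟩) (w := ⟨v, hv⟩) huv
  rw [isBridge_iff] at hb
  refine hb (hr'.mono fun x y hxy => ?_)
  simpa [Subtype.ext_iff] using hxy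

theorem IsCut.isTree_iff (h : T.IsCut S a b) :
    T.IsTree ↔ (T.induce S).IsTree ∧ (T.induce Sᶜ).IsTree := by
  constructor
  · intro hT
    exact ⟨⟨h.connected_induce hT.connected, hT.isAcyclic.induce S⟩,
      ⟨h.compl.connected_induce hT.connected, hT.isAcyclic.induce Sᶜ⟩⟩
  · rintro ⟨h₁, h₂⟩
    have hleft : ∀ x ∈ S, T.Reachable x a := fun x hx =>
      (h₁.connected.preconnected ⟨x, hx⟩ ⟨a, h.left_mem⟩).map (Embedding.induce S).toHom
    have hright : ∀ x ∉ S, T.Reachable x a := fun x hx =>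
      ((h₂.connected.preconnected ⟨x, hx⟩ ⟨b, h.right_notMem⟩).map
        (Embedding.induce Sᶜ).toHom).trans h.adj.symm.reachable
    have hall : ∀ x, T.Reachable x a := fun x => by
      by_cases hx : x ∈ S
      exacts [hleft x hx, hright x hx]
    have : Nonempty V := ⟨a⟩
    refine ⟨⟨fun x y => (hall x).trans (hall y).symm⟩, ?_⟩
    rw [isAcyclic_iff_forall_adj_isBridge]
    intro u v huv
    by_cases hu : u ∈ S <;> by_cases hv : v ∈ S
    · exact h.isBridge_of_mem h₁.isAcyclic hu hv huv
    · obtain ⟨rfl, rfl⟩ := h.eq_of_adj u v hu hv huv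
      exact isBridge_iff.2 h.not_reachable
    · obtain ⟨rfl, rfl⟩ := h.eq_of_adj v u hv hu huv.symm
      rw [Sym2.eq_swap]
      exact isBridge_iff.2 h.not_reachable
    · exact h.compl.isBridge_of_mem h₂.isAcyclic hu hv huv

/-- The set of vertices on the side of `a` once the edge `ab` is removed from `T`. -/
def side (T : SimpleGraph V) (a b : V) : Set V :=
  {x | (T.deleteEdges {s(a, b)}).Reachable a x}

theorem IsTree.isCut_side (hT : T.IsTree) (hab : T.Adj a b) : T.IsCut (T.side a b) a b := by
  have hb : b ∉ T.side a b :=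
    isBridge_iff.1 (isAcyclic_iff_forall_adj_isBridge.1 hT.isAcyclic hab)
  refine ⟨Reachable.refl a, hb, hab, fun x y hx hy hxy => ?_⟩
  have hmem : s(x, y) = s(a, b) := by
    by_contra hne
    exact hy (Reachable.trans hx (Adj.reachable (deleteEdges_adj.2 ⟨hxy, hne⟩)))
  rcases Sym2.eq_iff.1 hmem with h | h
  · exact h
  · exact absurd (h.1 ▸ hx) hb

theorem IsCut.side_eq (h : T.IsCut S a b) (hT : T.IsTree) : T.side a b = S := by
  ext x
  constructor
  · intro hx
    refine Reachable.mem_of_forall_adj (fun u v huv hu => ?_) hx h.left_mem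
    by_contra hv
    rw [deleteEdges_adj] at huv
    obtain ⟨rfl, rfl⟩ := h.eq_of_adj u v hu hv huv.1
    exact huv.2 rfl
  · intro hx
    have hr := (h.connected_induce hT.connected).preconnected ⟨a, h.left_mem⟩ ⟨x, hx⟩
    refine hr.of_forall_adj Subtype.val fun u v huv =>
      Adj.reachable (deleteEdges_adj.2 ⟨huv, fun he => h.right_notMem ?_⟩)
    rcases Sym2.eq_iff.1 he with ⟨-, h'⟩ | ⟨h', -⟩
    · exact h' ▸ v.2
    · exact h' ▸ u.2

theorem IsTree.side_eq_iff (hT : T.IsTree) (hab : T.Adj a b) :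
    T.side a b = S ↔ T.IsCut S a b :=
  ⟨fun h => h ▸ hT.isCut_side hab, fun h => h.side_eq hT⟩

/-- Trees on `S` and `Sᶜ` joined by the edge `ab`. -/
def glue (S : Set V) (T₁ : SimpleGraph S) (T₂ : SimpleGraph ↥Sᶜ) (a b : V) : SimpleGraph V :=
  T₁.map (Function.Embedding.subtype _) ⊔ T₂.map (Function.Embedding.subtype _) ⊔ edge a b

theorem isCut_glue (T₁ : SimpleGraph S) (T₂ : SimpleGraph ↥Sᶜ) (ha : a ∈ S) (hb : b ∉ S) :
    (glue S T₁ T₂ a b).IsCut S a b := by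
  have hne : a ≠ b := fun h => hb (h ▸ ha)
  refine ⟨ha, hb, by simp [glue, edge_adj, hne], ?_⟩
  rintro x y hx hy ((⟨-, u, v, -, rfl, rfl⟩ | ⟨-, u, v, -, rfl, rfl⟩) | hxy)
  · exact absurd v.2 hy
  · exact absurd hx u.2
  · rw [edge_adj] at hxy
    grind

theorem induce_glue (T₁ : SimpleGraph S) (T₂ : SimpleGraph ↥Sᶜ) (hb : b ∉ S) :
    (glue S T₁ T₂ a b).induce S = T₁ := by
  ext u v
  have hu := u.2
  have hv := v.2
  simp only [glue, comap_adj, sup_adj, map_adj, edge_adj]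
  constructor
  · rintro ((⟨x, y, hxy, hx, hy⟩ | ⟨x, y, hxy, hx, hy⟩) | h)
    · obtain rfl : x = u := Subtype.ext hx
      obtain rfl : y = v := Subtype.ext hy
      exact hxy
    · exact absurd ((show (x : V) = u from hx) ▸ u.2) x.2
    · simp only [Function.Embedding.subtype_apply] at h
      grind
  · intro h
    exact .inl (.inl ⟨u, v, h, rfl, rfl⟩)

theorem induce_compl_glue (T₁ : SimpleGraph S) (T₂ : SimpleGraph ↥Sᶜ) (ha : a ∈ S) :
    (glue S T₁ T₂ a b).induce Sᶜ = T₂ := by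
  ext u v
  have hu := u.2
  have hv := v.2
  simp only [glue, comap_adj, sup_adj, map_adj, edge_adj]
  constructor
  · rintro ((⟨x, y, hxy, hx, hy⟩ | ⟨x, y, hxy, hx, hy⟩) | h)
    · exact absurd x.2 ((show (x : V) = u from hx) ▸ u.2)
    · obtain rfl : x = u := Subtype.ext hx
      obtain rfl : y = v := Subtype.ext hy
      exact hxy
    · simp only [Function.Embedding.subtype_apply] at h
      grind
  · intro h
    exact .inl (.inr ⟨u, v, h, rfl, rfl⟩)

theorem IsCut.ext {T' : SimpleGraph V} (h : T.IsCut S a b) (h' : T'.IsCut S a b)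
    (h₁ : T.induce S = T'.induce S) (h₂ : T.induce Sᶜ = T'.induce Sᶜ) : T = T' := by
  have key : ∀ {T T' : SimpleGraph V}, T.IsCut S a b → T'.IsCut S a b →
      T.induce S = T'.induce S → T.induce Sᶜ = T'.induce Sᶜ → T ≤ T' := by
    intro T T' h h' h₁ h₂ u v huv
    by_cases hu : u ∈ S <;> by_cases hv : v ∈ S
    · have : (T.induce S).Adj ⟨u, hu⟩ ⟨v, hv⟩ := huv
      rw [h₁] at this
      exact this
    · obtain ⟨rfl, rfl⟩ := h.eq_of_adj u v hu hv huv
      exact h'.adj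
    · obtain ⟨rfl, rfl⟩ := h.eq_of_adj v u hv hu huv.symm
      exact h'.adj.symm
    · have : (T.induce Sᶜ).Adj ⟨u, hu⟩ ⟨v, hv⟩ := huv
      rw [h₂] at this
      exact this
  exact le_antisymm (key h h' h₁ h₂) (key h' h h₁.symm h₂.symm)

/-- A tree with a cut along `S` is the same as trees on `S` and `Sᶜ` with a vertex in each. -/
def isCutEquiv (S : Set V) :
    {p : SimpleGraph V × V × V // p.1.IsTree ∧ p.1.IsCut S p.2.1 p.2.2} ≃
      ({T : SimpleGraph S // T.IsTree} × {T : SimpleGraph ↥Sᶜ // T.IsTree}) × S × ↥Sᶜ where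
  toFun p := ((⟨p.1.1.induce S, (p.2.2.isTree_iff.1 p.2.1).1⟩,
    ⟨p.1.1.induce Sᶜ, (p.2.2.isTree_iff.1 p.2.1).2⟩),
    ⟨p.1.2.1, p.2.2.left_mem⟩, ⟨p.1.2.2, p.2.2.right_notMem⟩)
  invFun q := ⟨(glue S q.1.1.1 q.1.2.1 q.2.1 q.2.2, q.2.1, q.2.2), by
    have hc := isCut_glue q.1.1.1 q.1.2.1 q.2.1.2 q.2.2.2
    refine ⟨hc.isTree_iff.2 ⟨?_, ?_⟩, hc⟩
    · rw [induce_glue _ _ q.2.2.2]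
      exact q.1.1.2
    · rw [induce_compl_glue _ _ q.2.1.2]
      exact q.1.2.2⟩
  left_inv := by
    rintro ⟨⟨T, a, b⟩, hT, hc⟩
    simp only [Subtype.mk.injEq, Prod.mk.injEq, and_true]
    exact (isCut_glue _ _ hc.left_mem hc.right_notMem).ext hc
      (induce_glue _ _ hc.right_notMem)
      (induce_compl_glue _ _ hc.left_mem)
  right_inv := by
    rintro ⟨⟨⟨T₁, h₁⟩, ⟨T₂, h₂⟩⟩, ⟨a, ha⟩, ⟨b, hb⟩⟩
    simp only [Prod.mk.injEq, Subtype.mk.injEq, and_true]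
    exact ⟨induce_glue _ _ hb, induce_compl_glue _ _ ha⟩

end SimpleGraph

open Polynomial in
/-- A form of Abel's binomial theorem. -/
theorem Polynomial.sum_choose_mul_pow_mul_X_sub_pow (n : ℕ) :
    ∑ k ∈ Finset.range (n + 1),
      C ((n.choose k : ℚ) * (k ^ (k - 2) * k : ℕ)) * (X - C (k : ℚ)) ^ (n - k) =
      C (n : ℚ) * X ^ (n - 1) := by
  induction n with
  | zero => simp
  | succ n ih =>
    set P : ℚ[X] := ∑ k ∈ Finset.range (n + 1 + 1),
      C (((n + 1).choose k : ℚ) * (k ^ (k - 2) * k : ℕ)) * (X - C (k : ℚ)) ^ (n + 1 - k) with hP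
    have hderiv : derivative (P - C ((n + 1 : ℕ) : ℚ) * X ^ (n + 1 - 1)) = 0 := by
      have h : derivative P = C ((n + 1 : ℕ) : ℚ) * (C (n : ℚ) * X ^ (n - 1)) := by
        rw [← ih, hP, derivative_sum, Finset.sum_range_succ, Finset.mul_sum]
        have hlast : derivative (C (((n + 1).choose (n + 1) : ℚ) *
            ((n + 1 : ℕ) ^ (n + 1 - 2) * (n + 1 : ℕ) : ℕ)) *
            (X - C ((n + 1 : ℕ) : ℚ)) ^ (n + 1 - (n + 1))) = 0 := by
          rw [Nat.sub_self, pow_zero, mul_one, derivative_C]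
        rw [hlast, add_zero]
        refine Finset.sum_congr rfl fun k hk => ?_
        have hk : k ≤ n := Nat.lt_succ_iff.1 (Finset.mem_range.1 hk)
        have hc : ((n + 1).choose k : ℚ) * (n + 1 - k : ℕ) = (n + 1 : ℕ) * n.choose k := by
          exact_mod_cast (Nat.choose_mul_succ_eq n k).symm.trans (mul_comm _ _)
        rw [derivative_C_mul, derivative_X_sub_C_pow, show n + 1 - k - 1 = n - k by omega]
        rw [← mul_assoc, ← mul_assoc, ← C_mul, ← C_mul, ← mul_assoc, ← hc]
        congr 2
        ring
      rw [derivative_sub, h, derivative_C_mul, derivative_X_pow]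
      simp
    have hconst := eq_C_of_derivative_eq_zero hderiv
    have heval : (P - C ((n + 1 : ℕ) : ℚ) * X ^ (n + 1 - 1)).coeff 0 = 0 := by
      rw [coeff_zero_eq_eval_zero, eval_sub, hP, eval_finsetSum]
      rcases Nat.eq_zero_or_pos n with rfl | hn
      · simp [Finset.sum_range_succ]
      have h0 := congrFun (fwdDiff_iter_pow_eq_zero_of_lt (R := ℚ) (Nat.lt_succ_self n)) 0
      rw [fwdDiff_iter_eq_sum_shift] at h0
      simp only [eval_mul, eval_C, eval_pow, eval_sub, eval_X, Nat.add_sub_cancel, zero_pow hn.ne',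
        mul_zero, sub_zero]
      refine Eq.trans (Finset.sum_congr rfl fun k hk => ?_) h0
      have hk : k ≤ n + 1 := Nat.lt_succ_iff.1 (Finset.mem_range.1 hk)
      rcases Nat.eq_zero_or_pos k with rfl | hkpos
      · simp [hn.ne']
      have hpow : (k ^ (k - 2) * k : ℕ) = k ^ (k - 1) := by
        rcases Nat.lt_or_ge k 2 with h | h
        · obtain rfl : k = 1 := by omega
          rfl
        · rw [← pow_succ, show k - 2 + 1 = k - 1 by omega]
      rw [hpow, zero_sub, neg_pow]
      have hn' : (k : ℚ) ^ n = k ^ (k - 1) * k ^ (n + 1 - k) := by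
        rw [← pow_add]
        congr 1
        omega
      simp only [zero_add, nsmul_eq_mul, mul_one, zsmul_eq_mul]
      push_cast
      rw [hn']
      ring
    rw [heval, C_0, sub_eq_zero] at hconst
    exact hconst

/-- The recurrence satisfied by the numbers `n ^ (n - 2)` of labelled trees. -/
theorem Nat.sum_choose_mul_pow_mul_pow (n : ℕ) (hn : 2 ≤ n) :
    ∑ k ∈ Finset.range (n + 1),
      n.choose k * ((k ^ (k - 2) * k) * ((n - k) ^ (n - k - 2) * (n - k))) =
      n ^ (n - 2) * (2 * (n - 1)) := by
  set g : ℕ → ℕ := fun k => k ^ (k - 2) * k with hg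
  have hg' : ∀ k, 1 ≤ k → g k * k = k ^ k := fun k hk => by
    rcases Nat.lt_or_ge k 2 with h | h
    · obtain rfl : k = 1 := by omega
      rfl
    · simp only [hg]
      rw [← pow_succ, ← pow_succ, show k - 2 + 1 + 1 = k by omega]
  have habel : ∑ k ∈ Finset.range (n + 1), n.choose k * (g k * (n - k) ^ (n - k)) = n ^ n := by
    have h := congrArg (Polynomial.eval (n : ℚ))
      (Polynomial.sum_choose_mul_pow_mul_X_sub_pow n)
    rw [Polynomial.eval_finsetSum] at h
    simp only [Polynomial.eval_mul, Polynomial.eval_C, Polynomial.eval_pow, Polynomial.eval_sub,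
      Polynomial.eval_X] at h
    have hpow : (n : ℚ) * n ^ (n - 1) = n ^ n := by
      rw [← _root_.pow_succ', show n - 1 + 1 = n by omega]
    rw [hpow] at h
    rw [← Nat.cast_inj (R := ℚ), Nat.cast_pow, ← h, Nat.cast_sum]
    refine Finset.sum_congr rfl fun k hk => ?_
    have hk : k ≤ n := Nat.lt_succ_iff.1 (Finset.mem_range.1 hk)
    simp only [hg]
    push_cast [Nat.cast_sub hk]
    ring
  have hhalf : ∑ k ∈ Finset.range (n + 1), n.choose k * (g k * (g (n - k) * (n - k))) + g n
      = n ^ n := by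
    rw [← habel, Finset.sum_range_succ, Finset.sum_range_succ]
    simp only [Nat.sub_self, mul_zero, add_zero, Nat.choose_self, pow_zero, mul_one, one_mul]
    congr 1
    refine Finset.sum_congr rfl fun k hk => ?_
    rw [hg' (n - k) (by have := Finset.mem_range.1 hk; omega)]
  have hhalf' : ∑ k ∈ Finset.range (n + 1), n.choose k * (g k * k * g (n - k)) + g n
      = n ^ n := by
    rw [← hhalf, ← Finset.sum_range_reflect]
    congr 1
    refine Finset.sum_congr rfl fun k hk => ?_
    have hk : k ≤ n := Nat.lt_succ_iff.1 (Finset.mem_range.1 hk)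
    rw [show n + 1 - 1 - k = n - k by omega, Nat.choose_symm hk, show n - (n - k) = k by omega]
    ring
  have hsum : n * ∑ k ∈ Finset.range (n + 1), n.choose k * (g k * g (n - k)) + 2 * g n
      = 2 * n ^ n := by
    have : n * ∑ k ∈ Finset.range (n + 1), n.choose k * (g k * g (n - k)) =
        ∑ k ∈ Finset.range (n + 1), n.choose k * (g k * (g (n - k) * (n - k))) +
        ∑ k ∈ Finset.range (n + 1), n.choose k * (g k * k * g (n - k)) := by
      rw [Finset.mul_sum, ← Finset.sum_add_distrib]
      refine Finset.sum_congr rfl fun k hk => ?_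
      obtain ⟨m, rfl⟩ := Nat.exists_eq_add_of_le (Nat.lt_succ_iff.1 (Finset.mem_range.1 hk))
      rw [Nat.add_sub_cancel_left]
      ring
    omega
  change ∑ k ∈ Finset.range (n + 1), n.choose k * (g k * g (n - k)) = _
  obtain ⟨m, rfl⟩ := Nat.exists_eq_add_of_le' hn
  have hpos : 0 < m + 2 := by omega
  refine Nat.eq_of_mul_eq_mul_left hpos (Nat.add_right_cancel (hsum.trans ?_))
  simp only [hg, Nat.add_sub_cancel, show m + 2 - 1 = m + 1 by omega]
  ring

namespace SimpleGraph

variable {V : Type*} {T : SimpleGraph V} {S : Set V} {a b : V}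

theorem card_isTree_isCut [Finite V] (S : Set V) :
    Nat.card {p : SimpleGraph V × V × V // p.1.IsTree ∧ p.1.IsCut S p.2.1 p.2.2} =
      Nat.card {T : SimpleGraph S // T.IsTree} * Nat.card {T : SimpleGraph ↥Sᶜ // T.IsTree} *
        (S.ncard * Sᶜ.ncard) := by
  rw [Nat.card_congr (isCutEquiv S)]
  simp only [Nat.card_prod, Nat.card_coe_set_eq]

/-- Pairs of a tree and a dart, grouped by the side of the tail of the dart. -/
noncomputable def sideEquiv [Fintype V] (P : ℕ → Prop) :
    {p : SimpleGraph V × V × V //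
      p.1.IsTree ∧ p.1.Adj p.2.1 p.2.2 ∧ P (p.1.side p.2.1 p.2.2).ncard} ≃
    Σ s : {s : Finset V // P s.card},
      {p : SimpleGraph V × V × V // p.1.IsTree ∧ p.1.IsCut s.1 p.2.1 p.2.2} where
  toFun p := ⟨⟨(p.1.1.side p.1.2.1 p.1.2.2).toFinite.toFinset, by
      rw [← Set.ncard_eq_toFinset_card]; exact p.2.2.2⟩, p.1, p.2.1, by
      rw [Set.Finite.coe_toFinset]; exact p.2.1.isCut_side p.2.2.1⟩
  invFun q := ⟨q.2.1, q.2.2.1, q.2.2.2.adj, by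
    rw [q.2.2.2.side_eq q.2.2.1, Set.ncard_coe_finset]; exact q.1.2⟩
  left_inv _ := rfl
  right_inv := by
    rintro ⟨⟨s, hs⟩, p, hT, hc⟩
    have h : (p.1.side p.2.1 p.2.2).toFinite.toFinset = s := by
      rw [← Finset.coe_inj, Set.Finite.coe_toFinset, hc.side_eq hT]
    subst h
    rfl

theorem card_isTree_adj_side [Fintype V] (P : ℕ → Prop) [DecidablePred P] :
    Nat.card {p : SimpleGraph V × V × V //
      p.1.IsTree ∧ p.1.Adj p.2.1 p.2.2 ∧ P (p.1.side p.2.1 p.2.2).ncard} =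
    ∑ s : Finset V with P s.card,
      Nat.card {T : SimpleGraph (s : Set V) // T.IsTree} *
        Nat.card {T : SimpleGraph ↥(s : Set V)ᶜ // T.IsTree} *
        (s.card * (Fintype.card V - s.card)) := by
  classical
  rw [Nat.card_congr (sideEquiv P), Nat.card_sigma,
    Finset.sum_subtype (p := fun s : Finset V => P s.card) _ (fun s => by simp)]
  refine Finset.sum_congr rfl fun s _ => ?_
  rw [card_isTree_isCut, Set.ncard_coe_finset, Set.ncard_compl, Set.ncard_coe_finset,
    Nat.card_eq_fintype_card (α := V)]

theorem card_isTree_adj [Fintype V] :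
    Nat.card {p : SimpleGraph V × V × V // p.1.IsTree ∧ p.1.Adj p.2.1 p.2.2} =
      Nat.card {T : SimpleGraph V // T.IsTree} * (2 * (Fintype.card V - 1)) := by
  classical
  have e : {p : SimpleGraph V × V × V // p.1.IsTree ∧ p.1.Adj p.2.1 p.2.2} ≃
      Σ T : {T : SimpleGraph V // T.IsTree}, T.1.Dart :=
    { toFun := fun p => ⟨⟨p.1.1, p.2.1⟩, ⟨p.1.2, p.2.2⟩⟩
      invFun := fun q => ⟨(q.1.1, q.2.toProd), q.1.2, q.2.adj⟩
      left_inv := fun _ => rfl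
      right_inv := fun _ => rfl }
  rw [Nat.card_congr e, Nat.card_sigma]
  have h : ∀ T : {T : SimpleGraph V // T.IsTree},
      Nat.card T.1.Dart = 2 * (Fintype.card V - 1) := fun T => by
    rw [Nat.card_eq_fintype_card, dart_card_eq_twice_card_edges, ← T.2.card_edgeFinset,
      Nat.add_sub_cancel]
  simp only [h, Finset.sum_const, Finset.card_univ, smul_eq_mul, Nat.card_eq_fintype_card]

/-- **Cayley's formula** for the number of labelled trees. -/
theorem card_isTree [Fintype V] [Nonempty V] :
    Nat.card {T : SimpleGraph V // T.IsTree} = Fintype.card V ^ (Fintype.card V - 2) := by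
  classical
  induction hN : Fintype.card V using Nat.strong_induction_on generalizing V with
  | _ N ih =>
  have hNpos : 0 < N := hN ▸ Fintype.card_pos
  rcases Nat.lt_or_ge N 2 with hlt | hge
  · obtain rfl : N = 1 := by omega
    have : Subsingleton V := Fintype.card_le_one_iff_subsingleton.1 hN.le
    have hu : ∀ T : SimpleGraph V, T.IsTree := fun T => IsTree.of_subsingleton
    simp [hu]
  · have h := card_isTree_adj_side (V := V) (fun _ => True)
    simp only [and_true] at h
    rw [card_isTree_adj, hN] at h
    refine Nat.eq_of_mul_eq_mul_right (show 0 < 2 * (N - 1) by omega) (h.trans ?_)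
    rw [← Nat.sum_choose_mul_pow_mul_pow N hge, Finset.filter_true, ← Finset.powerset_univ]
    have hcard : (Finset.univ : Finset V).card = N := hN
    have hsum := Finset.sum_powerset_apply_card
      (fun k => (k ^ (k - 2) * k) * ((N - k) ^ (N - k - 2) * (N - k)))
      (x := (Finset.univ : Finset V))
    rw [hcard] at hsum
    simp only [smul_eq_mul] at hsum
    rw [← hsum]
    refine Finset.sum_congr rfl fun s _ => ?_
    have hs₂ : Fintype.card ↥(s : Set V)ᶜ = N - s.card := by
      rw [Fintype.card_compl_set, hN]
      simp
    have hs₁ : Fintype.card (s : Set V) = s.card := by simp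
    have hle : s.card ≤ N := hN ▸ Finset.card_le_univ s
    rcases Nat.eq_zero_or_pos s.card with h0 | hpos
    · simp [h0]
    rcases Nat.eq_zero_or_pos (N - s.card) with h0 | hpos'
    · simp [h0]
    have : Nonempty (s : Set V) := Fintype.card_pos_iff.1 (by omega)
    have : Nonempty ↥(s : Set V)ᶜ := Fintype.card_pos_iff.1 (by omega)
    rw [ih s.card (by omega) hs₁, ih (N - s.card) (by omega) hs₂]
    ring

theorem IsCut.eq_or_swap_eq [Finite V] {R : Set V} {c d : V} (hT : T.IsTree)
    (h : T.IsCut S a b) (h' : T.IsCut R c d) (hcard : R.ncard ≤ Sᶜ.ncard) (hb : b ∈ R) :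
    (c = a ∧ d = b) ∨ (c = b ∧ d = a) ∨ (c ∉ S ∧ d ∉ S) := by
  by_contra! hcon
  obtain ⟨h₁, h₂, h₃⟩ := hcon
  have hnot : ¬ (c ∈ S ∧ d ∉ S) := fun hx => by
    obtain ⟨rfl, rfl⟩ := h.eq_of_adj c d hx.1 hx.2 h'.adj
    exact h₁ rfl rfl
  have hnot' : ¬ (d ∈ S ∧ c ∉ S) := fun hx => by
    obtain ⟨rfl, rfl⟩ := h.eq_of_adj d c hx.1 hx.2 h'.adj.symm
    exact h₂ rfl rfl
  have hc : c ∈ S := by tauto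
  have hd : d ∈ S := by tauto
  have hsub : Sᶜ ⊆ R := fun x hx => by
    have hr := (h.compl.connected_induce hT.connected).preconnected ⟨b, h.right_notMem⟩ ⟨x, hx⟩
    refine hr.mem_of_forall_adj (S := Subtype.val ⁻¹' R) (fun u v huv hu => ?_) hb
    by_contra hv
    obtain ⟨hu', -⟩ := h'.eq_of_adj u v hu hv huv
    exact u.2 (hu' ▸ hc)
  have ha : a ∈ R := by
    by_contra ha
    obtain ⟨rfl, -⟩ := h'.eq_of_adj b a hb ha h.adj.symm
    exact h.right_notMem hc
  have hlt : Sᶜ.ncard < R.ncard := Set.ncard_lt_ncard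
    ((Set.ssubset_iff_of_subset hsub).2 ⟨a, ha, fun hn => hn h.left_mem⟩) (Set.toFinite _)
  omega

/-- A tree has at most one edge splitting it into halves of equal size. -/
theorem IsCut.eq_or_swap_eq_of_ncard_eq [Finite V] {R : Set V} {c d : V} (hT : T.IsTree)
    (h : T.IsCut S a b) (h' : T.IsCut R c d) (hS : Sᶜ.ncard = S.ncard)
    (hR : R.ncard = S.ncard) (hR' : Rᶜ.ncard = S.ncard) :
    (c = a ∧ d = b) ∨ (c = b ∧ d = a) := by
  have key : ∀ {S R : Set V} {a b c d : V}, T.IsCut S a b → T.IsCut R c d →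
      R.ncard = Sᶜ.ncard → Rᶜ.ncard = Sᶜ.ncard →
      (c = a ∧ d = b) ∨ (c = b ∧ d = a) ∨ (c ∉ S ∧ d ∉ S) := by
    intro S R a b c d h h' h₁ h₂
    by_cases hb : b ∈ R
    · exact h.eq_or_swap_eq hT h' h₁.le hb
    · have := h.eq_or_swap_eq hT h'.compl h₂.le hb
      tauto
  have k₁ := key h h' (by omega) (by omega)
  have k₂ := key h.compl h' (by rw [compl_compl]; omega) (by rw [compl_compl]; omega)
  simp only [Set.mem_compl_iff, not_not] at k₂
  tauto

end SimpleGraph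

theorem isSplittable_two_iff {V : Type*} [Fintype V] {T : SimpleGraph V} {n : ℕ}
    (hV : Fintype.card V = 2 * n) (hT : T.IsTree) :
    IsSplittable T 2 n ↔ ∃ a b, T.Adj a b ∧ (T.side a b).ncard = n := by
  constructor
  · rintro ⟨F, hF, hcard, hcomp⟩
    obtain ⟨e, rfl⟩ := Finset.card_eq_one.1 hcard
    induction e with
    | h a b =>
    refine ⟨a, b, by simpa using hF, ?_⟩
    rw [← hcomp ((T.deleteEdges ↑({s(a, b)} : Finset (Sym2 V))).connectedComponentMk a)]
    congr 1
    ext x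
    rw [ConnectedComponent.mem_supp_iff, ConnectedComponent.eq, Finset.coe_singleton]
    exact reachable_comm
  · rintro ⟨a, b, hab, hn⟩
    have hc := hT.isCut_side hab
    have hcompl : (T.side a b)ᶜ.ncard = n := by
      rw [Set.ncard_compl, Nat.card_eq_fintype_card]
      omega
    have hside : T.side b a = (T.side a b)ᶜ := hc.compl.side_eq hT
    refine ⟨{s(a, b)}, by simpa using hab, rfl, fun c => ?_⟩
    induction c using ConnectedComponent.ind with
    | h x =>
    by_cases hx : x ∈ T.side a b
    · rw [← hn]
      congr 1
      ext y
      rw [ConnectedComponent.mem_supp_iff, ConnectedComponent.eq, Finset.coe_singleton]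
      exact ⟨fun h => Reachable.trans hx h.symm, fun h => Reachable.trans (Reachable.symm h) hx⟩
    · have hx : x ∈ T.side b a := hside ▸ hx
      rw [← hcompl, ← hside]
      rw [side, Set.mem_ofPred_eq, Sym2.eq_swap] at hx
      congr 1
      ext y
      rw [ConnectedComponent.mem_supp_iff, ConnectedComponent.eq, Finset.coe_singleton, side,
        Set.mem_ofPred_eq, Sym2.eq_swap (a := b)]
      exact ⟨fun h => Reachable.trans hx h.symm, fun h => Reachable.trans (Reachable.symm h) hx⟩

theorem card_isTree_adj_side_eq {V : Type*} [Fintype V] {n : ℕ} (hV : Fintype.card V = 2 * n) :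
    Nat.card {p : SimpleGraph V × V × V //
      p.1.IsTree ∧ p.1.Adj p.2.1 p.2.2 ∧ (p.1.side p.2.1 p.2.2).ncard = n} =
    Nat.card {T : SimpleGraph V // T.IsTree ∧ IsSplittable T 2 n} * 2 := by
  classical
  have e : {p : SimpleGraph V × V × V //
      p.1.IsTree ∧ p.1.Adj p.2.1 p.2.2 ∧ (p.1.side p.2.1 p.2.2).ncard = n} ≃
      Σ T : {T : SimpleGraph V // T.IsTree ∧ IsSplittable T 2 n},
        {q : V × V | T.1.Adj q.1 q.2 ∧ (T.1.side q.1 q.2).ncard = n} :=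
    { toFun := fun p => ⟨⟨p.1.1, p.2.1, (isSplittable_two_iff hV p.2.1).2 ⟨_, _, p.2.2⟩⟩,
        ⟨p.1.2, p.2.2⟩⟩
      invFun := fun q => ⟨(q.1.1, q.2.1), q.1.2.1, q.2.2⟩
      left_inv := fun _ => rfl
      right_inv := fun _ => rfl }
  rw [Nat.card_congr e, Nat.card_sigma]
  have h : ∀ T : {T : SimpleGraph V // T.IsTree ∧ IsSplittable T 2 n},
      Nat.card {q : V × V | T.1.Adj q.1 q.2 ∧ (T.1.side q.1 q.2).ncard = n} = 2 := by
    rintro ⟨T, hT, hs⟩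
    obtain ⟨a, b, hab, hn⟩ := (isSplittable_two_iff hV hT).1 hs
    have hcompl : ∀ S : Set V, S.ncard = n → Sᶜ.ncard = n := fun S hS => by
      rw [Set.ncard_compl, Nat.card_eq_fintype_card]
      omega
    have hc := hT.isCut_side hab
    rw [Nat.card_coe_set_eq]
    refine Eq.trans ?_ (Set.ncard_pair (a := (a, b)) (b := (b, a))
      (fun he => hab.ne (congrArg Prod.fst he)))
    congr 1
    ext ⟨c, d⟩
    simp only [Set.mem_ofPred_eq, Set.mem_insert_iff, Set.mem_singleton_iff, Prod.mk.injEq]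
    constructor
    · rintro ⟨hcd, hn'⟩
      exact hc.eq_or_swap_eq_of_ncard_eq hT (hT.isCut_side hcd) ((hcompl _ hn).trans hn.symm)
        (hn'.trans hn.symm) ((hcompl _ hn').trans hn.symm)
    · rintro (⟨rfl, rfl⟩ | ⟨rfl, rfl⟩)
      · exact ⟨hab, hn⟩
      · exact ⟨hab.symm, by rw [hc.compl.side_eq hT]; exact hcompl _ hn⟩
  simp only [h, Finset.sum_const, Finset.card_univ, smul_eq_mul, Nat.card_eq_fintype_card]

theorem card_isTree_isSplittable_two {V : Type*} [Fintype V] {n : ℕ} (hn : 1 ≤ n)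
    (hV : Fintype.card V = 2 * n) :
    Nat.card {T : SimpleGraph V // T.IsTree ∧ IsSplittable T 2 n} * 2 =
      (2 * n).choose n * n ^ (2 * n - 2) := by
  classical
  rw [← card_isTree_adj_side_eq hV, card_isTree_adj_side (fun k => k = n)]
  have hterm : ∀ s : Finset V, s.card = n →
      Nat.card {T : SimpleGraph (s : Set V) // T.IsTree} *
        Nat.card {T : SimpleGraph ↥(s : Set V)ᶜ // T.IsTree} *
        (s.card * (Fintype.card V - s.card)) = n ^ (2 * n - 2) := by
    intro s hs
    have hs₁ : Fintype.card (s : Set V) = n := by simpa using hs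
    have hs₂ : Fintype.card ↥(s : Set V)ᶜ = n := by
      rw [Fintype.card_compl_set, hs₁]
      omega
    have : Nonempty (s : Set V) := Fintype.card_pos_iff.1 (by omega)
    have : Nonempty ↥(s : Set V)ᶜ := Fintype.card_pos_iff.1 (by omega)
    rw [card_isTree, card_isTree, hs₁, hs₂, hs, hV, show 2 * n - n = n by omega]
    rcases Nat.lt_or_ge n 2 with h | h
    · obtain rfl : n = 1 := by omega
      rfl
    · obtain ⟨m, rfl⟩ := Nat.exists_eq_add_of_le' h
      rw [show 2 * (m + 2) - 2 = m + m + 2 by omega, Nat.add_sub_cancel]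
      ring
  rw [Finset.sum_congr rfl fun s hs => hterm s (Finset.mem_filter.1 hs).2, Finset.sum_const,
    smul_eq_mul, Finset.univ_filter_card_eq,
    Finset.card_powersetCard, Finset.card_univ, hV]

theorem splitProb_eq {n : ℕ} (hn : 1 ≤ n) :
    splitProb n = (2 * n).choose n * (n : ℝ) ^ (2 * n - 2) /
      (2 * ((2 * n : ℕ) : ℝ) ^ (2 * n - 2)) := by
  have hV : Fintype.card (Fin (2 * n)) = 2 * n := Fintype.card_fin _
  have : Nonempty (Fin (2 * n)) := ⟨⟨0, by omega⟩⟩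
  have h₁ : numSplittableSpanningTrees (⊤ : SimpleGraph (Fin (2 * n))) 2 n * 2 =
      (2 * n).choose n * n ^ (2 * n - 2) := by
    rw [← card_isTree_isSplittable_two hn hV, numSplittableSpanningTrees, ← Nat.card_coe_set_eq]
    simp only [le_top, true_and]
    rfl
  have h₂ : numSpanningTrees (⊤ : SimpleGraph (Fin (2 * n))) = (2 * n) ^ (2 * n - 2) := by
    rw [numSpanningTrees, ← Nat.card_coe_set_eq]
    simp only [le_top, true_and]
    exact card_isTree.trans (by rw [hV])
  have h₁' : (numSplittableSpanningTrees (⊤ : SimpleGraph (Fin (2 * n))) 2 n : ℝ) * 2 =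
      (2 * n).choose n * (n : ℝ) ^ (2 * n - 2) := by exact_mod_cast h₁
  rw [splitProb, h₂, ← h₁']
  push_cast
  rw [mul_comm (2 : ℝ) ((2 * n : ℝ) ^ _), mul_div_mul_right _ _ two_ne_zero]

theorem Nat.sixteen_pow_le_four_mul_mul_centralBinom_sq {n : ℕ} (hn : 1 ≤ n) :
    16 ^ n ≤ 4 * n * n.centralBinom ^ 2 := by
  induction n, hn using Nat.le_induction with
  | base => decide
  | succ n hn ih =>
    have h := Nat.succ_mul_centralBinom_succ n
    have hpos : 0 < n * (n + 1) := by positivity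
    refine Nat.le_of_mul_le_mul_left ?_ hpos
    calc n * (n + 1) * 16 ^ (n + 1) = 16 * (n * (n + 1)) * 16 ^ n := by ring
      _ ≤ 16 * (n * (n + 1)) * (4 * n * n.centralBinom ^ 2) := by gcongr
      _ = 4 * n * (4 * (4 * n * (n + 1))) * n.centralBinom ^ 2 := by ring
      _ ≤ 4 * n * (4 * (2 * n + 1) ^ 2) * n.centralBinom ^ 2 := by
        gcongr
        nlinarith
      _ = 4 * n * (2 * (2 * n + 1) * n.centralBinom) ^ 2 := by ring
      _ = 4 * n * ((n + 1) * (n + 1).centralBinom) ^ 2 := by rw [h]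
      _ = n * (n + 1) * (4 * (n + 1) * (n + 1).centralBinom ^ 2) := by ring

theorem rpow_neg_half_le_splitProb {n : ℕ} (hn : 1 ≤ n) :
    (n : ℝ) ^ (-(1 : ℝ) / 2) ≤ splitProb n := by
  have hn0 : (0 : ℝ) < n := by exact_mod_cast hn
  have hprob : splitProb n = 2 * n.centralBinom / 4 ^ n := by
    rw [splitProb_eq hn, Nat.centralBinom]
    push_cast
    rw [mul_pow]
    have h4 : (4 : ℝ) ^ n = 2 ^ (2 * n - 2) * 4 := by
      rw [show (4 : ℝ) = 2 ^ 2 by norm_num, ← pow_mul, ← pow_add]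
      congr 1
      omega
    rw [h4]
    field_simp
    norm_num
  have hbinom : (16 : ℝ) ^ n ≤ 4 * n * (n.centralBinom : ℝ) ^ 2 := by
    exact_mod_cast Nat.sixteen_pow_le_four_mul_mul_centralBinom_sq hn
  rw [neg_div, Real.rpow_neg hn0.le, ← Real.sqrt_eq_rpow, hprob,
    inv_le_iff_one_le_mul₀ (by positivity), div_mul_eq_mul_div, le_div_iff₀ (by positivity), one_mul]
  refine le_of_sq_le_sq ?_ (by positivity)
  rw [mul_pow, mul_pow, Real.sq_sqrt hn0.le, ← pow_mul, mul_comm n 2, pow_mul]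
  norm_num
  linarith

/-- For `k = 2`, the probability that a uniformly random spanning tree of
`K_{2n}` is 2-splittable equals `(2n)! · n^(2n-2) / ((n!)^2 · 2 · (2n)^(2n-2))`, and this
quantity is at least `c · n^(-1/2)` for some constant `c > 0` and all sufficiently
large `n`. -/
theorem complete_graph_two_splittable :
    (∀ n : ℕ, 1 ≤ n →
      splitProb n =
        (Nat.factorial (2 * n) : ℝ) * (n : ℝ) ^ (2 * n - 2) /
          ((Nat.factorial n : ℝ) ^ 2 * 2 * ((2 * n : ℕ) : ℝ) ^ (2 * n - 2))) ∧
    ∃ c : ℝ, 0 < c ∧ ∃ N₀ : ℕ, ∀ n : ℕ, N₀ ≤ n →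
      splitProb n ≥ c * (n : ℝ) ^ (-(1 : ℝ) / 2) := by
  refine ⟨fun n hn => ?_, 1, one_pos, 1, fun n hn => ?_⟩
  · rw [splitProb_eq hn, Nat.cast_choose ℝ (show n ≤ 2 * n by omega),
      show 2 * n - n = n by omega, div_mul_eq_mul_div, div_div]
    congr 1
    ring
  · rw [one_mul]
    exact rpow_neg_half_le_splitProb hn
end

section
/- For any graph G with N vertices and m edges for which G is connected, the number of spanning trees of G is at most (1/N)·(2m/(N-1))^{N-1}. -/
open SimpleGraph

open Matrix in
/-- The **Cauchy–Binet formula**, summed over all maps into the inner index type rather than over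
its subsets of size `card n`. -/
theorem Matrix.factorial_mul_det_mul {n ι R : Type*} [Fintype n] [DecidableEq n] [Fintype ι]
    [CommRing R] (A : Matrix n ι R) (B : Matrix ι n R) :
    ((Fintype.card n).factorial : R) * (A * B).det =
      ∑ f : n → ι, (A.submatrix id f).det * (B.submatrix f id).det := by
  have expand : (A * B).det = ∑ f : n → ι, (∏ i, A i (f i)) * (B.submatrix f id).det := by
    have rows : A * B = fun i => ∑ j, A i j • B j := by
      ext i k
      simp [Matrix.mul_apply, Finset.sum_apply]
    rw [rows]
    refine (detRowAlternating.toMultilinearMap.map_sum (fun i j => A i j • B j)).trans ?_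
    refine Finset.sum_congr rfl fun f _ => ?_
    exact detRowAlternating.toMultilinearMap.map_smul_univ (fun i => A i (f i)) (fun i => B (f i))
  have permuted (σ : Equiv.Perm n) : (A * B).det =
      ∑ f : n → ι, (Equiv.Perm.sign σ * ∏ i, A i (f (σ i))) * (B.submatrix f id).det := by
    rw [expand, ← (Equiv.arrowCongr σ (Equiv.refl ι)).symm.sum_comp]
    refine Finset.sum_congr rfl fun f _ => ?_
    have h := det_permute σ (B.submatrix f id)
    rw [submatrix_submatrix] at h
    change (∏ i, A i (f (σ i))) * (B.submatrix (f ∘ σ) (id ∘ id)).det = _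
    rw [h]
    ring
  calc ((Fintype.card n).factorial : R) * (A * B).det
      = ∑ _σ : Equiv.Perm n, (A * B).det := by simp [Fintype.card_perm]
    _ = ∑ f : n → ι, ∑ σ : Equiv.Perm n,
          (Equiv.Perm.sign σ * ∏ i, A i (f (σ i))) * (B.submatrix f id).det := by
      rw [Finset.sum_comm]
      exact Finset.sum_congr rfl fun σ _ => permuted σ
    _ = _ := by
      refine Finset.sum_congr rfl fun f _ => ?_
      rw [← Finset.sum_mul, ← det_transpose (A.submatrix id f),
        det_apply' (A.submatrix id f)ᵀ]
      rfl

/-- The AM-GM inequality for the eigenvalues of a positive semidefinite matrix. -/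
theorem Matrix.PosSemidef.det_le_trace_div_card_pow {n : Type*} [Fintype n] [DecidableEq n]
    [Nonempty n] {A : Matrix n n ℝ} (hA : A.PosSemidef) :
    A.det ≤ (A.trace / Fintype.card n) ^ Fintype.card n := by
  have hcard : (Fintype.card n : ℝ) ≠ 0 := by simp
  have nonneg := hA.eigenvalues_nonneg
  have amgm := Real.geom_mean_le_arith_mean Finset.univ (fun _ => 1) hA.1.eigenvalues
    (by simp) (by simp [Fintype.card_pos]) (fun i _ => nonneg i)
  have det_eq : A.det = ∏ i, hA.1.eigenvalues i := by simpa using hA.1.det_eq_prod_eigenvalues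
  have trace_eq : A.trace = ∑ i, hA.1.eigenvalues i := by
    simpa using hA.1.trace_eq_sum_eigenvalues
  simp only [Real.rpow_one, one_mul, Finset.sum_const, Finset.card_univ, nsmul_eq_mul, mul_one,
    ← det_eq, ← trace_eq] at amgm
  have hdet : 0 ≤ A.det := hA.det_nonneg
  calc A.det = (A.det ^ (Fintype.card n : ℝ)⁻¹) ^ Fintype.card n :=
        (Real.rpow_inv_natCast_pow hdet Fintype.card_ne_zero).symm
    _ ≤ _ := pow_le_pow_left₀ (Real.rpow_nonneg hdet _) amgm _

namespace SimpleGraph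

variable {V : Type*} [DecidableEq V]

/-- The oriented vertex-edge incidence matrix of the complete graph, for an arbitrary choice of
orientation (with zero columns at loops), with an additional column of ones. -/
noncomputable def augIncMatrix (V : Type*) [DecidableEq V] : Matrix V (Option (Sym2 V)) ℤ :=
  fun v o => o.elim 1 fun e =>
    (Pi.single e.out.1 1 : V → ℤ) v - (Pi.single e.out.2 1 : V → ℤ) v

@[simp]
theorem augIncMatrix_none (v : V) : augIncMatrix V v none = 1 := rfl

theorem augIncMatrix_some (v : V) (e : Sym2 V) : augIncMatrix V v (some e) =
    (Pi.single e.out.1 1 : V → ℤ) v - (Pi.single e.out.2 1 : V → ℤ) v := rfl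

theorem sum_augIncMatrix_some [Fintype V] (e : Sym2 V) :
    ∑ v, augIncMatrix V v (some e) = 0 := by
  simp [augIncMatrix_some, Finset.sum_sub_distrib]

theorem sum_mul_augIncMatrix_some [Fintype V] (x : V → ℤ) (e : Sym2 V) :
    ∑ v, x v * augIncMatrix V v (some e) = x e.out.1 - x e.out.2 := by
  simp [augIncMatrix_some, mul_sub, Finset.sum_sub_distrib, Pi.single_apply]

theorem sum_augIncMatrix_some_sq [Fintype V] {e : Sym2 V} (he : ¬ e.IsDiag) :
    ∑ v, augIncMatrix V v (some e) ^ 2 = 2 := by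
  have hne : e.out.1 ≠ e.out.2 := by
    intro h
    apply he
    rw [← Quot.out_eq e]
    exact h
  simp only [sq]
  rw [sum_mul_augIncMatrix_some (fun v => augIncMatrix V v (some e))]
  simp [augIncMatrix_some, hne, hne.symm]

/-- The square submatrix of the augmented incidence matrix on the edges of a connected graph with
`card V - 1` edges has a nonzero determinant that is a multiple of `card V`. -/
theorem Connected.card_sq_le_det_augIncMatrix_sq [Fintype V] {T : SimpleGraph V}
    (hT : T.Connected) (e : V ≃ Option T.edgeSet) :
    (Fintype.card V : ℤ) ^ 2 ≤
      ((augIncMatrix V).submatrix id (fun w => (e w).map Subtype.val)).det ^ 2 := by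
  set M := (augIncMatrix V).submatrix id (fun w => (e w).map Subtype.val) with hM
  have := hT.nonempty
  have col_none (x : V → ℤ) : (Matrix.vecMul x M) (e.symm none) = ∑ v, x v := by
    simp [hM, Matrix.vecMul, dotProduct]
  have col_some (x : V → ℤ) (a : T.edgeSet) :
      (Matrix.vecMul x M) (e.symm (some a)) = x a.1.out.1 - x a.1.out.2 := by
    rw [← sum_mul_augIncMatrix_some]
    simp [hM, Matrix.vecMul, dotProduct]
  have det_ne : M.det ≠ 0 := by
    rw [Ne, ← Matrix.exists_vecMul_eq_zero_iff]
    rintro ⟨x, hx0, hx⟩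
    have adj {u v : V} (h : T.Adj u v) : x u = x v := by
      have h1 := col_some x ⟨s(u, v), h⟩
      rw [hx, Pi.zero_apply] at h1
      have h2 : s((s(u, v)).out.1, (s(u, v)).out.2) = s(u, v) := Quot.out_eq _
      rcases Sym2.eq_iff.1 h2 with ⟨ha, hb⟩ | ⟨ha, hb⟩ <;> simp only [ha, hb] at h1 <;> lia
    have const (u v : V) : x u = x v := by
      obtain ⟨p⟩ := hT.preconnected u v
      induction p with
      | nil => rfl
      | cons h _ ih => exact (adj h).trans ih
    apply hx0
    funext u
    have h := col_none x
    rw [hx, Finset.sum_congr rfl fun v _ => const v u] at h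
    simpa using h
  have dvd : (Fintype.card V : ℤ) ∣ M.det := by
    have ones : Matrix.vecMul (1 : V → ℤ) M =
        (Fintype.card V : ℤ) • Pi.single (e.symm none) 1 := by
      funext w
      obtain ⟨o, rfl⟩ := e.symm.surjective w
      cases o with
      | none => simp [col_none]
      | some a => simp [col_some]
    have h : Matrix.vecMul (1 : V → ℤ) (M * M.adjugate) = M.det • 1 := by
      rw [Matrix.mul_adjugate, Matrix.vecMul_smul, Matrix.vecMul_one]
    rw [← Matrix.vecMul_vecMul, ones, Matrix.smul_vecMul] at h
    obtain ⟨u⟩ := this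
    have hu := congrFun h u
    simp only [Pi.smul_apply, smul_eq_mul, Pi.one_apply, mul_one] at hu
    exact ⟨_, hu.symm⟩
  exact sq_le_sq.2 (by simpa using Int.le_of_dvd (abs_pos.2 det_ne) ((dvd_abs _ _).2 dvd))

variable [Fintype V]

/-- The augmented incidence matrix of `G`, whose column of ones is scaled by `c`. -/
noncomputable def scaledIncMatrix (G : SimpleGraph V) (c : ℝ) : Matrix V (Option G.edgeSet) ℝ :=
  fun v o => o.elim c fun e => (augIncMatrix V v (some e.1) : ℝ)

theorem trace_scaledIncMatrix_mul_transpose (G : SimpleGraph V) [DecidableRel G.Adj] (c : ℝ) :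
    (G.scaledIncMatrix c * (G.scaledIncMatrix c).transpose).trace =
      2 * G.edgeFinset.card + Fintype.card V * c ^ 2 := by
  have edge (e : G.edgeSet) : ∑ v, (augIncMatrix V v (some e.1) : ℝ) ^ 2 = 2 := by
    exact_mod_cast sum_augIncMatrix_some_sq (G.not_isDiag_of_mem_edgeSet e.2)
  simp only [Matrix.trace, Matrix.diag, Matrix.mul_apply, Matrix.transpose_apply, ← sq]
  rw [Finset.sum_comm, Fintype.sum_option]
  simp only [scaledIncMatrix, Option.elim_none, Option.elim_some, edge]
  simp [add_comm, mul_comm, edgeFinset_card]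

theorem IsTree.card_sq_mul_sq_le_det_sq {G T : SimpleGraph V} (hT : T.IsTree) (hTG : T ≤ G)
    (c : ℝ) (e : V ≃ Option T.edgeSet) :
    (Fintype.card V : ℝ) ^ 2 * c ^ 2 ≤ ((G.scaledIncMatrix c).submatrix id
      (Option.map (Set.inclusion (edgeSet_mono hTG)) ∘ e)).det ^ 2 := by
  classical
  have factor : (G.scaledIncMatrix c).submatrix id
      (Option.map (Set.inclusion (edgeSet_mono hTG)) ∘ e) =
      Matrix.of fun v w => (e w).elim c (fun _ => 1) *
        ((augIncMatrix V).submatrix id (fun w => (e w).map Subtype.val)).map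
          (Int.castRingHom ℝ) v w := by
    ext v w
    rcases h : e w with _ | a <;> simp [scaledIncMatrix, h]
  have weight : ∏ w, (e w).elim c (fun _ => (1 : ℝ)) = c := by
    rw [e.prod_comp (fun o => o.elim c (fun _ => (1 : ℝ))), Fintype.prod_option]
    simp
  have bound := hT.connected.card_sq_le_det_augIncMatrix_sq e
  rw [factor, Matrix.det_mul_row, weight, ← RingHom.mapMatrix_apply, ← RingHom.map_det, mul_pow,
    mul_comm, eq_intCast]
  refine mul_le_mul_of_nonneg_left ?_ (sq_nonneg c)
  exact_mod_cast bound

/-- A lower bound on the determinant of a perturbed Laplacian, one half of a form of the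
matrix-tree theorem. -/
theorem numSpanningTrees_mul_le_det (G : SimpleGraph V) [DecidableRel G.Adj] (c : ℝ) :
    numSpanningTrees G * ((Fintype.card V : ℝ) ^ 2 * c ^ 2) ≤
      (G.scaledIncMatrix c * (G.scaledIncMatrix c).transpose).det := by
  classical
  let S := {T : SimpleGraph V | T ≤ G ∧ T.IsTree}
  have equiv (T : S) : Nonempty (V ≃ Option T.1.edgeSet) := by
    rw [← Fintype.card_eq, Fintype.card_option, ← T.2.2.card_edgeFinset, edgeFinset_card]
  obtain ⟨e⟩ := Classical.nonempty_pi.2 equiv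
  let cols (p : S × Equiv.Perm V) : V → Option G.edgeSet :=
    Option.map (Set.inclusion (edgeSet_mono p.1.2.1)) ∘ (p.2.trans (e p.1))
  have mem_iff (p : S × Equiv.Perm V) (a : G.edgeSet) :
      some a ∈ Set.range (cols p) ↔ a.1 ∈ p.1.1.edgeSet := by
    rw [(p.2.trans (e p.1)).surjective.range_comp]
    constructor
    · rintro ⟨_ | b, hb⟩
      · simp at hb
      · rw [Option.map_some, Option.some_inj] at hb
        rw [← hb]
        exact b.2
    · exact fun h => ⟨some ⟨a.1, h⟩, rfl⟩
  have cols_injective : Function.Injective cols := by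
    rintro ⟨T, σ⟩ ⟨T', σ'⟩ h
    obtain rfl : T = T' := by
      apply Subtype.ext
      rw [← edgeSet_inj]
      ext a
      constructor <;> intro ha
      · have := (mem_iff (T, σ) ⟨a, edgeSet_mono T.2.1 ha⟩).2 ha
        rw [h] at this
        exact (mem_iff _ _).1 this
      · have := (mem_iff (T', σ') ⟨a, edgeSet_mono T'.2.1 ha⟩).2 ha
        rw [← h] at this
        exact (mem_iff _ _).1 this
    obtain rfl : σ = σ' := by
      ext v
      have hv := Option.map_injective (Set.inclusion_injective _) (congrFun h v)
      exact (e T).injective hv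
    rfl
  have card_S : (Fintype.card S : ℝ) = numSpanningTrees G := by
    rw [numSpanningTrees, ← Nat.card_coe_set_eq, Nat.card_eq_fintype_card]
  have fact_pos : (0 : ℝ) < (Fintype.card V).factorial := by
    exact_mod_cast Nat.factorial_pos _
  refine le_of_mul_le_mul_left ?_ fact_pos
  rw [Matrix.factorial_mul_det_mul]
  have transpose (f : V → Option G.edgeSet) :
      ((G.scaledIncMatrix c).transpose.submatrix f id).det =
        ((G.scaledIncMatrix c).submatrix id f).det := by
    rw [← Matrix.transpose_submatrix, Matrix.det_transpose]
  simp only [transpose, ← sq]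
  calc ((Fintype.card V).factorial : ℝ) *
        (numSpanningTrees G * ((Fintype.card V : ℝ) ^ 2 * c ^ 2))
      = ∑ _p : S × Equiv.Perm V, (Fintype.card V : ℝ) ^ 2 * c ^ 2 := by
        rw [Finset.sum_const, Finset.card_univ, Fintype.card_prod, Fintype.card_perm,
          nsmul_eq_mul, Nat.cast_mul, card_S]
        ring
    _ ≤ ∑ p, ((G.scaledIncMatrix c).submatrix id (cols p)).det ^ 2 :=
        Finset.sum_le_sum fun p _ =>
          p.1.2.2.card_sq_mul_sq_le_det_sq p.1.2.1 c (p.2.trans (e p.1))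
    _ = ∑ f ∈ Finset.univ.map ⟨cols, cols_injective⟩,
          ((G.scaledIncMatrix c).submatrix id f).det ^ 2 := by
        rw [Finset.sum_map]
        rfl
    _ ≤ _ := Finset.sum_le_univ_sum_of_nonneg fun f => sq_nonneg _

end SimpleGraph

/-- Grimmett's bound: For any connected graph `G` with `N` vertices and
`m` edges, the number of spanning trees of `G` is at most `(1/N) · (2m/(N-1))^(N-1)`. -/
theorem grimmett_bound {V : Type*} [Fintype V] [DecidableEq V]
    (G : SimpleGraph V) [DecidableRel G.Adj] (hG : G.Connected)
    (N m : ℕ) (hN : Fintype.card V = N) (hm : G.edgeFinset.card = m) (hN2 : 2 ≤ N) :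
    (numSpanningTrees G : ℝ) ≤
      (1 / (N : ℝ)) * ((2 * (m : ℝ)) / ((N : ℝ) - 1)) ^ (N - 1) := by
  have := hG.nonempty
  have hm_pos : 0 < m := by
    have h := hG.card_vert_le_card_edgeSet_add_one
    rw [Nat.card_eq_fintype_card, Nat.card_eq_fintype_card, ← edgeFinset_card, hN, hm] at h
    lia
  have hN_pos : (0 : ℝ) < N := by positivity
  have hN1_pos : (0 : ℝ) < N - 1 := by
    have : (2 : ℝ) ≤ N := by exact_mod_cast hN2
    linarith
  set s : ℝ := 2 * m / (N - 1) with hs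
  have hs_pos : 0 < s := by positivity
  have hsm : 2 * (m : ℝ) = s * (N - 1) := by
    rw [hs]
    field_simp
  set c : ℝ := √(s / N) with hc
  have hc_sq : c ^ 2 = s / N := Real.sq_sqrt (by positivity)
  have psd : (G.scaledIncMatrix c * (G.scaledIncMatrix c).transpose).PosSemidef := by
    simpa using Matrix.posSemidef_self_mul_conjTranspose (G.scaledIncMatrix c)
  have bound := (G.numSpanningTrees_mul_le_det c).trans psd.det_le_trace_div_card_pow
  rw [trace_scaledIncMatrix_mul_transpose, hN, hm, hc_sq, hsm] at bound
  have mean : (s * ((N : ℝ) - 1) + N * (s / N)) / N = s := by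
    field_simp
    ring
  have weight : (N : ℝ) ^ 2 * (s / N) = N * s := by field_simp
  rw [mean, weight, ← Nat.sub_add_cancel (by lia : 1 ≤ N), pow_succ, Nat.sub_add_cancel (by lia),
    ← mul_assoc] at bound
  rw [one_div, inv_mul_eq_div, le_div_iff₀ hN_pos]
  exact le_of_mul_le_mul_right bound hs_pos
end
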